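/- arXiv:0803.0420 — 3 statements merged into one kernel-verified Lean document; each statement's English description precedes it below -/
import Mathlib

section
/- The prime counting function π(x), defined as the number of primes ≤ x, satisfies π(x) · log x / x → 1 as x → ∞. -/
noncomputable def primePi (x : ℝ) : ℝ := Nat.primeCounting ⌊x⌋₊

open FourierTransform MeasureTheory Filter Topology

lemma pnt_kernel : ∃ g : ℝ → ℂ, Continuous g ∧ HasCompactSupport g ∧ Integrable (𝓕 g) ∧
    Integrable (fun w => ‖w‖ * ‖𝓕 g w‖) ∧ ∫ w, 𝓕 g w = 1 := by
  obtain ⟨f, -, hf1, hf2, -, hf3⟩ := exists_contDiff_tsupport_subset (n := ⊤)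
    (univ_mem : (Set.univ : Set ℝ) ∈ 𝓝 (0:ℝ))
  have h1 : HasCompactSupport (fun x => (f x : ℂ)) := hf1.comp_left (g := ((↑) : ℝ → ℂ)) (by simp)
  have h2 : ContDiff ℝ ((⊤ : ℕ∞) : WithTop ℕ∞) (fun x => (f x : ℂ)) :=
    Complex.ofRealCLM.contDiff.comp hf2
  have hc : Continuous (fun x => (f x : ℂ)) := h2.continuous
  set g : SchwartzMap ℝ ℂ := h1.toSchwartzMap h2 with hg
  have hgc : ⇑g = fun x => (f x : ℂ) := rfl
  have hi : Integrable (𝓕 (fun x => (f x : ℂ))) := by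
    rw [← hgc, ← SchwartzMap.fourier_coe]; exact (𝓕 g).integrable
  refine ⟨fun x => (f x : ℂ), hc, h1, hi, ?_, ?_⟩
  · rw [← hgc, ← SchwartzMap.fourier_coe]
    have := SchwartzMap.integrable_pow_mul volume (𝓕 g) 1
    simp_rw [pow_one] at this
    exact this
  · have := hc.fourierInv_fourier_eq (hc.integrable_of_hasCompactSupport h1) hi
    have := congrFun this 0
    rw [Real.fourierInv_eq'] at this
    simpa [hf3] using this

lemma pnt_laplace_fourier (h : ℝ → ℂ) (hm : Measurable h) (M : ℝ) (hM : ∀ u, ‖h u‖ ≤ M)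
    (h0 : ∀ u ≤ 0, h u = 0) (G : ℂ → ℂ) (hG : ContinuousOn G {s | 0 ≤ s.re})
    (hL : ∀ s : ℂ, 0 < s.re → ∫ u : ℝ, h u * Complex.exp (-s * u) = G s)
    (g : ℝ → ℂ) (hg : Continuous g) (hgs : HasCompactSupport g) (hgi : Integrable (𝓕 g)) :
    Tendsto (fun y : ℝ => ∫ u : ℝ, h u * 𝓕 g (u - y)) atTop (𝓝 0) := by
  have hgint : Integrable g := hg.integrable_of_hasCompactSupport hgs
  have hint : ∀ δ : ℝ, 0 < δ → Integrable (fun u : ℝ => h u * Complex.exp (-δ * u)) := by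
    intro δ hδ
    have h1 : Integrable ((Set.Ioi (0:ℝ)).indicator (fun u : ℝ => M * Real.exp (-δ * u))) :=
      (integrable_indicator_iff measurableSet_Ioi).2 ((exp_neg_integrableOn_Ioi 0 hδ).const_mul M)
    refine h1.mono' (by fun_prop) (ae_of_all _ fun u => ?_)
    by_cases hu : 0 < u
    · rw [Set.indicator_of_mem (by exact hu), norm_mul, Complex.norm_exp]
      simp only [neg_mul, Complex.neg_re, Complex.mul_re, Complex.ofReal_re, Complex.ofReal_im,
        mul_zero, sub_zero]
      gcongr
      exact hM u
    · rw [h0 u (not_lt.1 hu), Set.indicator_of_notMem (by simpa using hu)]; simp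
  -- the key identity
  have key : ∀ δ : ℝ, 0 < δ → ∀ y : ℝ, ∫ u : ℝ, h u * Complex.exp (-δ * u) * 𝓕 g (u - y) =
      ∫ t : ℝ, Complex.exp (((2 * Real.pi * t * y : ℝ) : ℂ) * Complex.I) *
        (g t * G (δ + ((2 * Real.pi * t : ℝ) : ℂ) * Complex.I)) := by
    intro δ hδ y
    have hI : Integrable (Function.uncurry fun (u t : ℝ) =>
        h u * Complex.exp (-δ * u) *
          (Complex.exp (((-2 * Real.pi * t * (u - y) : ℝ) : ℂ) * Complex.I) * g t))
        (volume.prod volume) := by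
      have := (hint δ hδ).mul_prod hgint
      refine this.mono (by
        apply Measurable.aestronglyMeasurable
        have := hg.measurable
        unfold Function.uncurry
        fun_prop) (ae_of_all _ fun z => ?_)
      simp only [Function.uncurry, norm_mul, Complex.norm_exp_ofReal_mul_I, one_mul, le_refl]
    calc _ = ∫ u : ℝ, ∫ t : ℝ, h u * Complex.exp (-δ * u) *
          (Complex.exp (((-2 * Real.pi * t * (u - y) : ℝ) : ℂ) * Complex.I) * g t) := by
            congr 1; ext u
            rw [integral_const_mul, Real.fourier_real_eq_integral_exp_smul]
            simp
      _ = _ := by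
        rw [integral_integral_swap hI]
        congr 1; ext t
        rw [← hL _ (by simpa using hδ), ← integral_const_mul, ← integral_const_mul]
        congr 1; ext u
        have : Complex.exp (-δ * u) *
          (Complex.exp (((-2 * Real.pi * t * (u - y) : ℝ) : ℂ) * Complex.I)) =
          Complex.exp (((2 * Real.pi * t * y : ℝ) : ℂ) * Complex.I) *
          Complex.exp (-(δ + ((2 * Real.pi * t : ℝ) : ℂ) * Complex.I) * u) := by
          rw [← Complex.exp_add, ← Complex.exp_add]
          congr 1
          push_cast
          ring
        linear_combination (h u * g t) * this
  have key0 : ∀ y : ℝ, ∫ u : ℝ, h u * 𝓕 g (u - y) =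
      ∫ t : ℝ, Complex.exp (((2 * Real.pi * t * y : ℝ) : ℂ) * Complex.I) *
        (g t * G (((2 * Real.pi * t : ℝ) : ℂ) * Complex.I)) := by
    intro y
    have hpos : ∀ᶠ δ : ℝ in 𝓝[>] 0, 0 < δ := self_mem_nhdsWithin
    have hle : ∀ᶠ δ : ℝ in 𝓝[>] 0, δ ≤ 1 := by
      apply nhdsWithin_le_nhds; exact eventually_le_nhds one_pos
    have hKi : Integrable (fun u => 𝓕 g (u - y)) := hgi.comp_sub_right y
    have t1 : Tendsto (fun δ : ℝ => ∫ u : ℝ, h u * Complex.exp (-δ * u) * 𝓕 g (u - y))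
        (𝓝[>] 0) (𝓝 (∫ u : ℝ, h u * 𝓕 g (u - y))) := by
      refine tendsto_integral_filter_of_dominated_convergence
        (fun u => M * ‖𝓕 g (u - y)‖) ?_ ?_ (hKi.norm.const_mul M) ?_
      · filter_upwards with δ
        have := hKi.aestronglyMeasurable
        exact (Measurable.aestronglyMeasurable (by fun_prop)).mul this
      · filter_upwards [hpos] with δ hδ
        refine ae_of_all _ fun u => ?_
        rw [norm_mul]
        gcongr
        by_cases hu : 0 < u
        · rw [norm_mul, Complex.norm_exp]
          have : Real.exp (-δ * u : ℂ).re ≤ 1 := by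
            simp; positivity
          calc _ ≤ ‖h u‖ * 1 := by gcongr
            _ ≤ M := by simpa using hM u
        · rw [h0 u (not_lt.1 hu)]; simpa using (norm_nonneg _).trans (hM 0)
      · refine ae_of_all _ fun u => ?_
        have : Tendsto (fun δ : ℝ => h u * Complex.exp (-δ * u) * 𝓕 g (u - y)) (𝓝 0)
          (𝓝 (h u * Complex.exp (-((0:ℝ):ℂ) * u) * 𝓕 g (u - y))) := by
          apply Continuous.tendsto; fun_prop
        simp only [Complex.ofReal_zero, neg_zero, zero_mul, Complex.exp_zero, mul_one] at this
        exact this.mono_left nhdsWithin_le_nhds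
    have hGc : ∀ δ : ℝ, 0 ≤ δ → Continuous
        (fun t : ℝ => G (δ + ((2 * Real.pi * t : ℝ) : ℂ) * Complex.I)) := by
      intro δ hδ
      exact hG.comp_continuous (by fun_prop) (fun t => by simpa using hδ)
    have t2 : Tendsto (fun δ : ℝ => ∫ t : ℝ,
        Complex.exp (((2 * Real.pi * t * y : ℝ) : ℂ) * Complex.I) *
        (g t * G (δ + ((2 * Real.pi * t : ℝ) : ℂ) * Complex.I))) (𝓝[>] 0)
        (𝓝 (∫ t : ℝ, Complex.exp (((2 * Real.pi * t * y : ℝ) : ℂ) * Complex.I) *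
        (g t * G (((2 * Real.pi * t : ℝ) : ℂ) * Complex.I)))) := by
      obtain ⟨C, hC⟩ : ∃ C, ∀ p ∈ (Set.Icc (0:ℝ) 1) ×ˢ tsupport g,
          ‖G (p.1 + ((2 * Real.pi * p.2 : ℝ) : ℂ) * Complex.I)‖ ≤ C := by
        apply (isCompact_Icc.prod hgs.isCompact).exists_bound_of_continuousOn
        refine hG.comp (Continuous.continuousOn (by fun_prop)) ?_
        rintro ⟨a, b⟩ ⟨ha, -⟩
        simpa using ha.1
      refine tendsto_integral_filter_of_dominated_convergence
        (fun t => C * ‖g t‖) ?_ ?_ (hgint.norm.const_mul C) ?_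
      · filter_upwards [hpos] with δ hδ
        have := hGc δ hδ.le
        exact ((by fun_prop : Continuous fun t : ℝ =>
          Complex.exp (((2 * Real.pi * t * y : ℝ) : ℂ) * Complex.I)).mul
            (hg.mul this)).aestronglyMeasurable
      · filter_upwards [hpos, hle] with δ hδ hδ1
        refine ae_of_all _ fun t => ?_
        rw [norm_mul, norm_mul, Complex.norm_exp_ofReal_mul_I, one_mul, mul_comm]
        by_cases ht : t ∈ tsupport g
        · gcongr
          exact hC (δ, t) ⟨⟨hδ.le, hδ1⟩, ht⟩
        · rw [image_eq_zero_of_notMem_tsupport ht]; simp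
      · refine ae_of_all _ fun t => ?_
        refine Tendsto.const_mul _ (Tendsto.const_mul _ ?_)
        have hcw := hG (((2 * Real.pi * t : ℝ) : ℂ) * Complex.I) (by simp)
        refine hcw.tendsto.comp (tendsto_nhdsWithin_iff.2 ⟨?_, ?_⟩)
        · have : Tendsto (fun δ : ℝ => (δ : ℂ) + ((2 * Real.pi * t : ℝ) : ℂ) * Complex.I) (𝓝 0)
            (𝓝 (((0:ℝ) : ℂ) + ((2 * Real.pi * t : ℝ) : ℂ) * Complex.I)) := by
            apply Continuous.tendsto; fun_prop
          rw [Complex.ofReal_zero, zero_add] at this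
          exact this.mono_left nhdsWithin_le_nhds
        · filter_upwards [hpos] with δ hδ
          simpa using hδ.le
    refine tendsto_nhds_unique t1 (t2.congr' ?_)
    filter_upwards [hpos] with δ hδ
    exact (key δ hδ y).symm
  have RL := Real.zero_at_infty_fourier
    (fun t : ℝ => g t * G (((2 * Real.pi * t : ℝ) : ℂ) * Complex.I))
  have : Tendsto (fun y : ℝ => -y) atTop (cocompact ℝ) :=
    tendsto_neg_atTop_atBot.mono_right atBot_le_cocompact
  refine (RL.comp this).congr fun y => ?_
  rw [key0, Function.comp, Real.fourier_real_eq_integral_exp_smul]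
  congr 1; ext t
  rw [smul_eq_mul]
  congr 3
  push_cast; ring
lemma pnt_fourier_scale (g : ℝ → ℂ) (l : ℝ) (hl : 0 < l) (v : ℝ) :
    𝓕 (fun t => g (t / l)) v = l * 𝓕 g (l * v) := by
  rw [Real.fourier_real_eq_integral_exp_smul, Real.fourier_real_eq_integral_exp_smul]
  have := Measure.integral_comp_div
    (fun t : ℝ => Complex.exp (((-2 * Real.pi * t * (l * v) : ℝ) : ℂ) * Complex.I) • g t) l
  rw [abs_of_pos hl, Complex.real_smul] at this
  rw [← this]
  congr 1; ext t
  congr 4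
  field_simp

lemma pnt_scale (h g : ℝ → ℂ) (l : ℝ) (hl : 0 < l) (y : ℝ) :
    ∫ u, h u * 𝓕 (fun t => g (t / l)) (u - y) = ∫ w, h (y + w / l) * 𝓕 g w := by
  have h1 := integral_add_left_eq_self (μ := volume)
    (fun u => h u * 𝓕 (fun t => g (t / l)) (u - y)) y
  have h2 := Measure.integral_comp_mul_left (fun w => h (y + w / l) * 𝓕 g w) l
  rw [← h1]
  simp_rw [pnt_fourier_scale g l hl]
  rw [abs_of_pos (by positivity), Complex.real_smul] at h2
  have hl' : (l : ℂ) ≠ 0 := by exact_mod_cast hl.ne'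
  have h3 : ∫ w, h (y + w / l) * 𝓕 g w = l * ∫ x, h (y + l * x / l) * 𝓕 g (l * x) := by
    rw [h2]; push_cast; field_simp
  rw [h3, ← integral_const_mul]
  congr 1; ext x
  rw [mul_div_cancel_left₀ x hl.ne', add_sub_cancel_left]
  ring

lemma pnt_average (h : ℝ → ℂ) (hm : Measurable h) (M : ℝ) (hM : ∀ u, ‖h u‖ ≤ M)
    (K : ℝ → ℂ) (hK : Integrable K) (hK1 : Integrable (fun w => ‖w‖ * ‖K w‖))
    (hK2 : ∫ w, K w = 1)
    (hT : ∀ l : ℝ, 0 < l → Tendsto (fun y : ℝ => ∫ w, h (y + w / l) * K w) atTop (𝓝 0))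
    (ε : ℝ) (hε : 0 < ε) :
    Tendsto (fun y : ℝ => ∫ u in y..(y + ε), h u) atTop (𝓝 0) := by
  have hM0 : 0 ≤ M := (norm_nonneg _).trans (hM 0)
  have hii : ∀ a b, IntervalIntegrable h volume a b := fun a b =>
    intervalIntegrable_const (c := M) |>.mono_fun' hm.aestronglyMeasurable
      (ae_of_all _ fun u => hM u)
  set A : ℝ → ℂ := fun y => ∫ u in y..(y + ε), h u with hA
  have hAlip : ∀ y z, ‖A z - A y‖ ≤ 2 * M * |z - y| := by
    intro y z
    have e : A z - A y = (∫ u in (y+ε)..(z+ε), h u) - ∫ u in y..z, h u := by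
      have e1 := intervalIntegral.integral_add_adjacent_intervals (hii y z) (hii z (z+ε))
      have e2 := intervalIntegral.integral_add_adjacent_intervals (hii y (y+ε)) (hii (y+ε) (z+ε))
      simp only [hA]
      linear_combination e1 - e2
    rw [e]
    have b1 := intervalIntegral.norm_integral_le_of_norm_le_const (f := h) (a := y+ε) (b := z+ε)
      (C := M) (fun u _ => hM u)
    have b2 := intervalIntegral.norm_integral_le_of_norm_le_const (f := h) (a := y) (b := z)
      (C := M) (fun u _ => hM u)
    rw [add_sub_add_right_eq_sub] at b1
    calc _ ≤ _ := norm_sub_le _ _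
      _ ≤ _ := by linarith
  have hAc : Continuous A := by
    have : LipschitzWith (Real.toNNReal (2 * M)) A := by
      apply LipschitzWith.of_dist_le_mul
      intro z y
      rw [dist_eq_norm, Real.dist_eq, Real.coe_toNNReal _ (by positivity)]
      exact hAlip y z
    exact this.continuous
  have hAb : ∀ y, ‖A y‖ ≤ M * ε := by
    intro y
    have := intervalIntegral.norm_integral_le_of_norm_le_const (f := h) (a := y) (b := y+ε)
      (C := M) (fun u _ => hM u)
    simpa [abs_of_pos hε] using this
  set C := ∫ w, ‖w‖ * ‖K w‖ with hC
  have hC0 : 0 ≤ C := integral_nonneg fun w => by positivity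
  have fub : ∀ l : ℝ, 0 < l → ∀ y, ∫ z in y..(y+ε), ∫ w, h (z + w / l) * K w =
      ∫ w, A (y + w / l) * K w := by
    intro l hl y
    have hI : Integrable (Function.uncurry fun (z w : ℝ) => h (z + w / l) * K w)
        ((volume.restrict (Set.uIoc y (y+ε))).prod volume) := by
      have h1 : Integrable (fun _ : ℝ => (M : ℂ)) (volume.restrict (Set.uIoc y (y+ε))) := by
        rw [Set.uIoc_of_le (by linarith)]
        exact integrable_const _
      refine (h1.mul_prod hK).mono ?_ (ae_of_all _ fun z => ?_)
      · refine AEStronglyMeasurable.mul ?_ hK.aestronglyMeasurable.comp_snd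
        exact Measurable.aestronglyMeasurable (by fun_prop)
      · simp only [Function.uncurry, norm_mul]
        gcongr
        simpa [abs_of_nonneg hM0] using hM _
    rw [intervalIntegral.intervalIntegral_eq_integral_uIoc]
    rw [integral_integral_swap hI, if_pos (by linarith), one_smul]
    congr 1; ext w
    rw [integral_mul_const]
    congr 1
    have := intervalIntegral.integral_comp_add_right (a := y) (b := y + ε) h (w / l)
    rw [intervalIntegral.intervalIntegral_eq_integral_uIoc, if_pos (by linarith), one_smul] at this
    rw [this, hA]
    simp only
    congr 1; ring
  have hdiff : ∀ l : ℝ, 0 < l → ∀ y, ‖(∫ w, A (y + w / l) * K w) - A y‖ ≤ 2 * M / l * C := by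
    intro l hl y
    have i1 : Integrable (fun w => A (y + w / l) * K w) := by
      refine hK.bdd_mul (c := M * ε) ?_ (ae_of_all _ fun w => hAb _)
      exact Continuous.aestronglyMeasurable (by fun_prop)
    have : A y = ∫ w, A y * K w := by rw [integral_const_mul, hK2, mul_one]
    rw [this, ← integral_sub i1 (hK.const_mul _), hC, ← integral_const_mul]
    refine norm_integral_le_of_norm_le (hK1.const_mul _) (ae_of_all _ fun w => ?_)
    rw [← sub_mul, norm_mul]
    have := hAlip y (y + w / l)
    rw [add_sub_cancel_left, abs_div, abs_of_pos hl] at this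
    calc _ ≤ 2 * M * (|w| / l) * ‖K w‖ := by gcongr
      _ = _ := by rw [Real.norm_eq_abs]; ring
  rw [Metric.tendsto_atTop]
  intro η hη
  obtain ⟨l, hl, hl2⟩ : ∃ l : ℝ, 0 < l ∧ 2 * M / l * C < η / 2 := by
    refine ⟨(4 * M * C + 1) / η, by positivity, ?_⟩
    have : 0 < 4 * M * C + 1 := by positivity
    rw [div_div_eq_mul_div, div_mul_eq_mul_div, div_lt_iff₀ this]
    nlinarith
  obtain ⟨N, hN⟩ := (Metric.tendsto_atTop.1 (hT l hl)) (η / (2 * ε)) (by positivity)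
  refine ⟨N, fun y hy => ?_⟩
  have b1 : ‖∫ z in y..(y+ε), ∫ w, h (z + w / l) * K w‖ ≤ η / (2 * ε) * |y + ε - y| := by
    apply intervalIntegral.norm_integral_le_of_norm_le_const
    intro z hz
    rw [Set.uIoc_of_le (by linarith)] at hz
    have := hN z (by linarith [hz.1])
    rw [dist_zero_right] at this
    exact this.le
  rw [add_sub_cancel_left, abs_of_pos hε, fub l hl] at b1
  have b2 := hdiff l hl y
  rw [dist_zero_right]
  have e3 : η / (2 * ε) * ε = η / 2 := by field_simp
  have : A y = (∫ w, A (y + w / l) * K w) - ((∫ w, A (y + w / l) * K w) - A y) := by ring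
  rw [this]
  refine (norm_sub_le _ _).trans_lt ?_
  linarith

lemma pnt_tauber (φ : ℝ → ℝ) (hmono : Monotone (fun u => Real.exp u * φ u)) (h0 : ∀ u, 0 ≤ φ u)
    (hi : ∀ a b, IntervalIntegrable φ volume a b)
    (hA : ∀ ε : ℝ, 0 < ε → Tendsto (fun y : ℝ => ∫ u in y..(y + ε), (φ u - 1)) atTop (𝓝 0)) :
    Tendsto φ atTop (𝓝 1) := by
  have hcomp : ∀ u v, u ≤ v → φ u ≤ Real.exp (v - u) * φ v := by
    intro u v huv
    have := hmono huv
    simp only at this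
    rw [Real.exp_sub, div_mul_eq_mul_div, le_div_iff₀ (Real.exp_pos _)]
    linarith
  have hA' : ∀ ε : ℝ, 0 < ε → Tendsto (fun y : ℝ => ε⁻¹ * ∫ u in y..(y + ε), φ u) atTop (𝓝 1) := by
    intro ε hε
    have := ((hA ε hε).const_mul ε⁻¹).add_const 1
    rw [mul_zero, zero_add] at this
    refine this.congr fun y => ?_
    rw [intervalIntegral.integral_sub (hi _ _) (by simp), intervalIntegral.integral_const]
    simp only [add_sub_cancel_left, smul_eq_mul, mul_one]
    field_simp
    ring
  have up : ∀ ε : ℝ, 0 < ε → ∀ y, φ y ≤ Real.exp ε * (ε⁻¹ * ∫ u in y..(y + ε), φ u) := by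
    intro ε hε y
    have : ∫ u in y..(y+ε), φ y ≤ ∫ u in y..(y+ε), Real.exp ε * φ u := by
      apply intervalIntegral.integral_mono_on (by linarith) (by simp) ((hi _ _).const_mul _)
      intro u hu
      refine (hcomp y u hu.1).trans ?_
      gcongr
      · exact h0 u
      · linarith [hu.2]
    rw [intervalIntegral.integral_const, intervalIntegral.integral_const_mul] at this
    simp only [add_sub_cancel_left, smul_eq_mul] at this
    have h2 : φ y = ε⁻¹ * (ε * φ y) := by field_simp
    rw [h2]
    calc _ ≤ ε⁻¹ * (Real.exp ε * ∫ u in y..(y + ε), φ u) := by gcongr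
      _ = _ := by ring
  have low : ∀ ε : ℝ, 0 < ε → ∀ y,
      Real.exp (-ε) * (ε⁻¹ * ∫ u in (y-ε)..(y - ε + ε), φ u) ≤ φ y := by
    intro ε hε y
    have : ∫ u in (y-ε)..(y-ε+ε), φ u ≤ ∫ u in (y-ε)..(y-ε+ε), Real.exp ε * φ y := by
      apply intervalIntegral.integral_mono_on (by linarith) (hi _ _) (by simp)
      intro u hu
      refine (hcomp u y (by linarith [hu.2])).trans ?_
      gcongr
      · exact h0 y
      · linarith [hu.1]
    rw [intervalIntegral.integral_const] at this
    simp only [add_sub_cancel_left, smul_eq_mul] at this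
    calc _ ≤ Real.exp (-ε) * (ε⁻¹ * (ε * (Real.exp ε * φ y))) := by gcongr
      _ = _ := by rw [Real.exp_neg]; field_simp
  rw [tendsto_order]
  constructor
  · intro a ha
    obtain ⟨ε, hε, hε2⟩ : ∃ ε : ℝ, 0 < ε ∧ a < Real.exp (-ε) := by
      have : Tendsto (fun ε : ℝ => Real.exp (-ε)) (𝓝[>] 0) (𝓝 1) := by
        have : Tendsto (fun ε : ℝ => Real.exp (-ε)) (𝓝 0) (𝓝 (Real.exp (-0))) :=
          Continuous.tendsto (by fun_prop) _
        simp only [neg_zero, Real.exp_zero] at this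
        exact this.mono_left nhdsWithin_le_nhds
      exact ((eventually_mem_nhdsWithin (a := (0:ℝ)) (s := Set.Ioi 0)).and
        (this.eventually_const_lt ha)).exists
    have t := ((hA' ε hε).comp (tendsto_atTop_add_const_right atTop (-ε) tendsto_id)).const_mul
      (Real.exp (-ε))
    rw [mul_one] at t
    filter_upwards [Tendsto.eventually_const_lt hε2 t] with y hy
    exact hy.trans_le (low ε hε y)
  · intro a ha
    obtain ⟨ε, hε, hε2⟩ : ∃ ε : ℝ, 0 < ε ∧ Real.exp ε < a := by
      have : Tendsto (fun ε : ℝ => Real.exp ε) (𝓝[>] 0) (𝓝 1) := by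
        have : Tendsto (fun ε : ℝ => Real.exp ε) (𝓝 0) (𝓝 (Real.exp 0)) :=
          Continuous.tendsto (by fun_prop) _
        simp only [Real.exp_zero] at this
        exact this.mono_left nhdsWithin_le_nhds
      exact ((eventually_mem_nhdsWithin (a := (0:ℝ)) (s := Set.Ioi 0)).and
        (Tendsto.eventually_lt_const ha this)).exists
    have t := (hA' ε hε).const_mul (Real.exp ε)
    rw [mul_one] at t
    filter_upwards [Tendsto.eventually_lt_const hε2 t] with y hy
    exact (up ε hε y).trans_lt hy
lemma pnt_laplace (s : ℂ) (hs : 0 < s.re) :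
    LSeries (fun n => ((ArithmeticFunction.vonMangoldt n : ℝ) : ℂ)) (s + 1) =
      (s + 1) * ∫ u in Set.Ioi (0:ℝ),
        ((Chebyshev.psi (Real.exp u) * Real.exp (-u) : ℝ) : ℂ) * Complex.exp (-s * u) := by
  have hpsi : ∀ t : ℝ, ∑ k ∈ Finset.Icc 1 ⌊t⌋₊, ArithmeticFunction.vonMangoldt k =
      Chebyshev.psi t := by
    intro t
    rw [Chebyshev.psi]
    rfl
  have hO : (fun n : ℕ ↦ ∑ k ∈ Finset.Icc 1 n, ArithmeticFunction.vonMangoldt k) =O[atTop]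
      fun n ↦ (n : ℝ) ^ (1:ℝ) := by
    refine Asymptotics.IsBigO.of_bound (Real.log 4 + 4) (Eventually.of_forall fun n => ?_)
    have := hpsi n
    rw [Nat.floor_natCast] at this
    rw [this, Real.rpow_one, Real.norm_of_nonneg (Chebyshev.psi_nonneg _),
      Real.norm_of_nonneg (Nat.cast_nonneg _)]
    exact Chebyshev.psi_le_const_mul_self (Nat.cast_nonneg _)
  rw [LSeries_eq_mul_integral_of_nonneg _ zero_le_one (by simpa using hs) hO
    (fun n => ArithmeticFunction.vonMangoldt_nonneg)]
  congr 1
  have himg : Real.exp '' Set.Ioi 0 = Set.Ioi 1 := by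
    ext t
    constructor
    · rintro ⟨u, hu, rfl⟩
      simpa using hu
    · intro ht
      exact ⟨Real.log t, Real.log_pos ht, Real.exp_log (one_pos.trans ht)⟩
  rw [← himg, integral_image_eq_integral_abs_deriv_smul measurableSet_Ioi
    (fun x _ => (Real.hasDerivAt_exp x).hasDerivWithinAt) Real.exp_injective.injOn]
  refine setIntegral_congr_fun measurableSet_Ioi fun u _ => ?_
  beta_reduce
  rw [abs_of_pos (Real.exp_pos u), Complex.real_smul, ← hpsi]
  have : ((Real.exp u : ℝ) : ℂ) ^ (-(s + 1 + 1)) = Complex.exp (-(s+1+1) * u) := by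
    rw [Complex.cpow_def_of_ne_zero (by exact_mod_cast (Real.exp_pos u).ne'),
      ← Complex.ofReal_log (Real.exp_pos u).le, Real.log_exp, mul_comm]
  rw [this]
  push_cast
  have : Complex.exp u * Complex.exp (-(s+1+1) * u) = Complex.exp (-u) * Complex.exp (-s * u) := by
    rw [← Complex.exp_add, ← Complex.exp_add]; congr 1; ring
  linear_combination (∑ k ∈ Finset.Icc 1 ⌊Real.exp u⌋₊,
    ((ArithmeticFunction.vonMangoldt k : ℝ) : ℂ)) * this

lemma pnt_psi : Tendsto (fun u : ℝ => Chebyshev.psi (Real.exp u) * Real.exp (-u)) atTop (𝓝 1) := by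
  set φ : ℝ → ℝ := fun u => Chebyshev.psi (Real.exp u) * Real.exp (-u) with hφ
  have hφ0 : ∀ u, 0 ≤ φ u := fun u => mul_nonneg (Chebyshev.psi_nonneg _) (Real.exp_pos _).le
  set B := Real.log 4 + 4 with hB
  have hB0 : 0 ≤ B := by have := Real.log_nonneg (x := 4) (by norm_num); positivity
  have hφB : ∀ u, φ u ≤ B := by
    intro u
    have := Chebyshev.psi_le_const_mul_self (Real.exp_pos u).le
    calc φ u ≤ B * Real.exp u * Real.exp (-u) := by simp only [hφ]; gcongr
      _ = B := by rw [Real.exp_neg]; field_simp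
  have hφm : Measurable φ :=
    (Chebyshev.psi_mono.measurable.comp Real.measurable_exp).mul (by fun_prop)
  have hφi : ∀ a b, IntervalIntegrable φ volume a b := fun a b =>
    intervalIntegrable_const (c := B) |>.mono_fun' hφm.aestronglyMeasurable
      (ae_of_all _ fun u => by simpa [abs_of_nonneg (hφ0 u)] using hφB u)
  set h : ℝ → ℂ := (Set.Ioi (0:ℝ)).indicator (fun u => ((φ u - 1 : ℝ) : ℂ)) with hh
  have hhm : Measurable h := Measurable.indicator (by fun_prop) measurableSet_Ioi
  have hhM : ∀ u, ‖h u‖ ≤ B + 1 := by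
    intro u
    refine (norm_indicator_le_norm_self _ _).trans ?_
    rw [Complex.norm_real, Real.norm_eq_abs, abs_le]
    constructor <;> linarith [hφ0 u, hφB u]
  have hh0 : ∀ u ≤ 0, h u = 0 := fun u hu => Set.indicator_of_notMem (by simpa using hu) _
  set Aux := ArithmeticFunction.vonMangoldt.LFunctionResidueClassAux (q := 1) 1 with hAux
  have hAuxc : ContinuousOn Aux {s | 1 ≤ s.re} :=
    ArithmeticFunction.vonMangoldt.continuousOn_LFunctionResidueClassAux (q := 1) 1
  have hAuxe : ∀ s : ℂ, 1 < s.re → Aux s =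
      LSeries (fun n => ((ArithmeticFunction.vonMangoldt n : ℝ) : ℂ)) s - 1 / (s - 1) := by
    intro s hs
    have := ArithmeticFunction.vonMangoldt.eqOn_LFunctionResidueClassAux (q := 1) (a := 1)
      isUnit_one hs
    rw [hAux, this]
    simp only [Nat.totient_one, Nat.cast_one, inv_one]
    congr 2
    ext n
    rw [ArithmeticFunction.vonMangoldt.residueClass, Set.indicator_of_mem]
    exact Subsingleton.elim _ _
  have main : ∀ ε : ℝ, 0 < ε → Tendsto (fun y : ℝ => ∫ u in y..(y + ε), h u) atTop (𝓝 0) := by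
    obtain ⟨g, hg, hgs, hgi, hg1, hg2⟩ := pnt_kernel
    refine pnt_average h hhm _ hhM (𝓕 g) hgi hg1 hg2 fun l hl => ?_
    simp_rw [← pnt_scale h g l hl]
    refine pnt_laplace_fourier h hhm _ hhM hh0 (fun s => (Aux (s + 1) - 1) / (s + 1)) ?_ ?_ _
      (by fun_prop) ?_ ?_
    · refine ContinuousOn.div (ContinuousOn.sub (hAuxc.comp (by fun_prop) ?_) continuousOn_const)
        (by fun_prop) ?_
      · intro s hs
        simpa using hs
      · intro s hs h1
        have := congrArg Complex.re h1
        simp at this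
        have h2 : 0 ≤ s.re := hs
        linarith
    · intro s hs
      have hs0 : s ≠ 0 := by rintro rfl; simp at hs
      have hs1 : s + 1 ≠ 0 := by
        intro h1
        have := congrArg Complex.re h1
        simp at this
        linarith
      have hexp : IntegrableOn (fun u : ℝ => Complex.exp (-s * u)) (Set.Ioi 0) :=
        integrableOn_exp_mul_complex_Ioi (by simpa using hs) 0
      have i1 : IntegrableOn (fun u : ℝ => (φ u : ℂ) * Complex.exp (-s * u)) (Set.Ioi 0) := by
        refine Integrable.bdd_mul (c := B) hexp (Measurable.aestronglyMeasurable (by fun_prop)) ?_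
        exact ae_of_all _ fun u => by simpa [abs_of_nonneg (hφ0 u)] using hφB u
      have e1 : ∫ u : ℝ, h u * Complex.exp (-s * u) =
          ∫ u in Set.Ioi (0:ℝ), ((φ u : ℂ) * Complex.exp (-s * u) - Complex.exp (-s * u)) := by
        rw [← integral_indicator measurableSet_Ioi]
        congr 1; ext u
        by_cases hu : u ∈ Set.Ioi (0:ℝ)
        · simp only [hh, Set.indicator_of_mem hu]; push_cast; ring
        · simp only [hh, Set.indicator_of_notMem hu]; ring
      rw [e1, integral_sub i1 hexp, integral_exp_mul_complex_Ioi (by simpa using hs)]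
      have e2 := pnt_laplace s hs
      have e3 := hAuxe (s + 1) (by simpa using hs)
      rw [e2, add_sub_cancel_right] at e3
      simp only [e3, hφ]
      simp only [Complex.ofReal_zero, mul_zero, Complex.exp_zero]
      field_simp
      ring
    · exact hgs.comp_homeomorph (Homeomorph.mulRight₀ l⁻¹ (by positivity))
    · have : 𝓕 (fun t => g (t / l)) = fun v => l * 𝓕 g (l * v) := by
        ext v; exact pnt_fourier_scale g l hl v
      rw [this]
      exact (hgi.comp_mul_left' hl.ne').const_mul _
  refine pnt_tauber φ ?_ hφ0 hφi fun ε hε => ?_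
  · have : (fun u => Real.exp u * φ u) = fun u => Chebyshev.psi (Real.exp u) := by
      ext u; simp only [hφ]; rw [Real.exp_neg]; field_simp
    rw [this]
    exact Chebyshev.psi_mono.comp Real.exp_monotone
  · have := (Complex.continuous_re.tendsto 0).comp (main ε hε)
    rw [Complex.zero_re] at this
    refine this.congr' ?_
    filter_upwards [eventually_gt_atTop 0] with y hy
    have e : ∫ u in y..(y + ε), h u = ∫ u in y..(y+ε), ((φ u - 1 : ℝ) : ℂ) := by
      apply intervalIntegral.integral_congr
      intro u hu
      rw [Set.uIcc_of_le (by linarith)] at hu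
      exact Set.indicator_of_mem (show u ∈ Set.Ioi 0 from hy.trans_le hu.1) _
    rw [Function.comp, e, intervalIntegral.integral_ofReal, Complex.ofReal_re]

theorem prime_number_theorem :
    Filter.Tendsto (fun x : ℝ => primePi x * Real.log x / x) Filter.atTop (nhds 1) := by
  have h1 : Tendsto (fun x : ℝ => Chebyshev.psi x / x) atTop (𝓝 1) := by
    refine (pnt_psi.comp Real.tendsto_log_atTop).congr' ?_
    filter_upwards [eventually_gt_atTop 0] with x hx
    simp only [Function.comp, Real.exp_neg, Real.exp_log hx, div_eq_mul_inv]
  have h2 : Tendsto (fun x : ℝ => (Chebyshev.psi x - Chebyshev.theta x) / x) atTop (𝓝 0) := by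
    have := Chebyshev.isBigO_psi_sub_theta_sqrt.trans_isLittleO (k := fun x : ℝ => x) ?_
    · exact this.tendsto_div_nhds_zero
    · refine Asymptotics.isLittleO_of_tendsto' ?_ ?_
      · filter_upwards [eventually_gt_atTop 0] with x hx hx0
        exact absurd hx0 hx.ne'
      · refine Real.tendsto_sqrt_atTop.inv_tendsto_atTop.congr fun x => ?_
        rw [Real.sqrt_div_self, Pi.inv_apply]
  have h3 : Tendsto (fun x : ℝ => (Nat.primeCounting ⌊x⌋₊ - Chebyshev.theta x / Real.log x) *
      Real.log x / x) atTop (𝓝 0) := by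
    have h4 : (fun x : ℝ => (Nat.primeCounting ⌊x⌋₊ - Chebyshev.theta x / Real.log x) *
      Real.log x / x) =O[atTop] (fun x : ℝ => x / Real.log x ^ 2 * (Real.log x / x)) := by
      refine (Chebyshev.primeCounting_sub_theta_div_log_isBigO.mul
        (Asymptotics.isBigO_refl (fun x : ℝ => Real.log x / x) atTop)).congr_left fun x => ?_
      ring
    refine h4.trans_tendsto (Real.tendsto_log_atTop.inv_tendsto_atTop.congr' ?_)
    filter_upwards [eventually_gt_atTop 1] with x hx
    have := Real.log_pos hx
    simp only [Pi.inv_apply]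
    field_simp
  have h5 := (h3.add h1).sub h2
  simp only [zero_add, sub_zero] at h5
  refine h5.congr' ?_
  filter_upwards [eventually_gt_atTop 1] with x hx
  have := Real.log_pos hx
  rw [primePi]
  field_simp
  ring
end

section
/- If the limit of π(x)·log x / x as x → ∞ exists, then it equals 1. -/
open Filter Topology Asymptotics in
/-- The residue of the L-series of the von Mangoldt function at `1` is `1`. -/
lemma vonMangoldt_residue :
    Tendsto (fun s : ℝ => ((s : ℂ) - 1) *
      LSeries (fun n => ((ArithmeticFunction.vonMangoldt n : ℝ) : ℂ)) s) (𝓝[>] 1) (𝓝 1) := by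
  have hc := ArithmeticFunction.vonMangoldt.continuousOn_LFunctionResidueClassAux (q := 1) 1
  have hcast : Tendsto (fun s : ℝ => (s : ℂ)) (𝓝[>] 1) (𝓝[{s : ℂ | 1 ≤ s.re}] 1) := by
    refine tendsto_nhdsWithin_iff.mpr ⟨?_, ?_⟩
    · exact (Complex.continuous_ofReal.tendsto' 1 1 (by simp)).mono_left nhdsWithin_le_nhds
    · filter_upwards [self_mem_nhdsWithin] with s hs
      simpa using le_of_lt hs
  have h1 := (hc 1 (by simp)).tendsto.comp hcast
  have h2 : Tendsto (fun s : ℝ => (s : ℂ) - 1) (𝓝[>] 1) (𝓝 0) :=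
    ((by fun_prop : Continuous fun s : ℝ => (s : ℂ) - 1).tendsto' 1 0 (by simp)).mono_left
      nhdsWithin_le_nhds
  have h3 := (h2.mul h1).add_const 1
  rw [zero_mul, zero_add] at h3
  refine h3.congr' ?_
  filter_upwards [self_mem_nhdsWithin] with s hs
  have hs' : (1 : ℝ) < s := hs
  have hne : (s : ℂ) - 1 ≠ 0 := by
    rw [sub_ne_zero]; exact_mod_cast hs'.ne'
  have h4 := ArithmeticFunction.vonMangoldt.eqOn_LFunctionResidueClassAux (q := 1) (a := 1)
    isUnit_one (x := (s : ℂ)) (by simpa using hs')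
  have h5 : ∀ n, ArithmeticFunction.vonMangoldt.residueClass (1 : ZMod 1) n
      = ArithmeticFunction.vonMangoldt n := fun n => by
    simp [ArithmeticFunction.vonMangoldt.residueClass,
      Subsingleton.elim (n : ZMod 1) 1]
  simp only [h5] at h4
  simp only [Function.comp_apply, h4]
  simp only [Nat.totient_one, Nat.cast_one, inv_one]
  field_simp
  ring

open Filter Topology Asymptotics in
theorem chebyshev_limit (L : ℝ)
    (h : Filter.Tendsto (fun x : ℝ => primePi x * Real.log x / x) Filter.atTop (nhds L)) :
    L = 1 := by
  have hθ : Tendsto (fun x : ℝ => Chebyshev.theta x / x) atTop (𝓝 L) := by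
    have ho := Chebyshev.integral_theta_div_log_sq_isLittleO.tendsto_div_nhds_zero
    have := h.sub ho
    rw [sub_zero] at this
    refine this.congr' ?_
    filter_upwards [eventually_ge_atTop 2] with x hx
    have hl : 0 < Real.log x := Real.log_pos (by linarith)
    rw [primePi, Chebyshev.primeCounting_eq_theta_div_log_add_integral hx]
    field_simp
    ring
  have hψ : Tendsto (fun x : ℝ => Chebyshev.psi x / x) atTop (𝓝 L) := by
    have hs : Real.sqrt =o[atTop] (fun x : ℝ => x) := by
      refine (isLittleO_iff_tendsto' ?_).mpr ?_
      · filter_upwards [eventually_gt_atTop 0] with x hx h0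
        exact absurd h0 hx.ne'
      · simp only [Real.sqrt_div_self', one_div]
        exact Real.tendsto_sqrt_atTop.inv_tendsto_atTop
    have ho := (Chebyshev.isBigO_psi_sub_theta_sqrt.trans_isLittleO hs).tendsto_div_nhds_zero
    have := hθ.add ho
    rw [add_zero] at this
    refine this.congr fun x => ?_
    simp only [Pi.sub_apply]
    ring
  have hn := hψ.comp tendsto_natCast_atTop_atTop
  have key := LSeries_tendsto_sub_mul_nhds_one_of_tendsto_sum_div_and_nonneg
    (fun n => ArithmeticFunction.vonMangoldt n) (l := L)
    (hn.congr fun n => by simp [Chebyshev.psi]; rfl)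
    (fun n => ArithmeticFunction.vonMangoldt_nonneg)
  exact_mod_cast tendsto_nhds_unique key vonMangoldt_residue
end

section
/- f(x) = log x - x/π(x) tends to 1 as x → ∞. -/
namespace PNT
open Complex Filter Topology

/-- Terms of the series for `ζ(s) - 1/(s-1)`. -/
noncomputable def zterm (n : ℕ) (s : ℂ) : ℂ :=
  ((n + 1 : ℝ) : ℂ) ^ (-s) - (((n + 1 : ℝ) : ℂ) ^ (1 - s) - ((n + 2 : ℝ) : ℂ) ^ (1 - s)) / (s - 1)

lemma cpow_sub_bound {N u : ℝ} (hN : 1 ≤ N) (hu : N ≤ u) (hu' : u ≤ N + 1) {s : ℂ} (hs : 0 < s.re) :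
    ‖(N : ℂ) ^ (-s) - (u : ℂ) ^ (-s)‖ ≤ ‖s‖ * N ^ (-s.re - 1) := by
  have hs0 : -s ≠ 0 := by
    intro h
    rw [neg_eq_zero.mp h] at hs
    simp at hs
  have hN0 : 0 < N := by linarith
  have key := Convex.norm_image_sub_le_of_norm_hasDerivWithin_le (𝕜 := ℝ) (s := Set.Icc N (N + 1))
    (f := fun y : ℝ => (y : ℂ) ^ (-s)) (f' := fun y : ℝ => (-s) * (y : ℂ) ^ (-s - 1))
    (C := ‖s‖ * N ^ (-s.re - 1)) (x := u) (y := N) ?_ ?_ (convex_Icc _ _) ⟨hu, hu'⟩ ⟨le_rfl, by linarith⟩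
  · refine key.trans ?_
    have h1 : ‖N - u‖ ≤ 1 := by
      rw [Real.norm_eq_abs, abs_le]; constructor <;> linarith
    have h2 : 0 ≤ ‖s‖ * N ^ (-s.re - 1) := by positivity
    nlinarith
  · intro y hy
    have hy0 : y ≠ 0 := by linarith [hy.1]
    exact (hasDerivAt_ofReal_cpow_const hy0 hs0).hasDerivWithinAt
  · intro y hy
    have hy0 : 0 < y := by linarith [hy.1]
    rw [norm_mul, norm_neg, norm_cpow_eq_rpow_re_of_pos hy0]
    gcongr
    have : (-s - 1).re = -s.re - 1 := by simp
    rw [this]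
    exact Real.rpow_le_rpow_of_nonpos hN0 hy.1 (by linarith)

lemma cpow_sub_bound' {N u : ℝ} (hN : 1 ≤ N) (hu : N ≤ u) {s : ℂ} (hs : 0 < s.re) :
    ‖(N : ℂ) ^ (-s) - (u : ℂ) ^ (-s)‖ ≤ 2 * N ^ (-s.re) := by
  have hN0 : 0 < N := by linarith
  refine (norm_sub_le _ _).trans ?_
  rw [norm_cpow_eq_rpow_re_of_pos hN0, norm_cpow_eq_rpow_re_of_pos (by linarith), neg_re]
  have := Real.rpow_le_rpow_of_nonpos hN0 hu (z := -s.re) (by linarith)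
  linarith

lemma zterm_bound_of {n : ℕ} {s : ℂ} (hs1 : s ≠ 1) {B : ℝ}
    (h : ∀ u : ℝ, (n + 1 : ℝ) ≤ u → u ≤ n + 2 →
      ‖((n + 1 : ℝ) : ℂ) ^ (-s) - (u : ℂ) ^ (-s)‖ ≤ B) : ‖zterm n s‖ ≤ B := by
  have hs0 : 1 - s ≠ 0 := sub_ne_zero.mpr (Ne.symm hs1)
  have hs0' : s - 1 ≠ 0 := sub_ne_zero.mpr hs1
  have key := Convex.norm_image_sub_le_of_norm_hasDerivWithin_le (𝕜 := ℝ)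
    (s := Set.Icc (n + 1 : ℝ) (n + 2))
    (f := fun y : ℝ => ((n + 1 : ℝ) : ℂ) ^ (-s) * (y : ℂ) - (y : ℂ) ^ (1 - s) / (1 - s))
    (f' := fun y : ℝ => ((n + 1 : ℝ) : ℂ) ^ (-s) - (y : ℂ) ^ (-s))
    (C := B) (x := n + 1) (y := n + 2) ?_ ?_ (convex_Icc _ _) ⟨le_rfl, by linarith⟩ ⟨by linarith, le_rfl⟩
  · have e : (((n + 1 : ℝ) : ℂ) ^ (-s) * ((n + 2 : ℝ) : ℂ) - ((n + 2 : ℝ) : ℂ) ^ (1 - s) / (1 - s)) -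
      (((n + 1 : ℝ) : ℂ) ^ (-s) * ((n + 1 : ℝ) : ℂ) - ((n + 1 : ℝ) : ℂ) ^ (1 - s) / (1 - s)) = zterm n s := by
      unfold zterm
      have h12 : ((n + 2 : ℝ) : ℂ) = ((n + 1 : ℝ) : ℂ) + 1 := by push_cast; ring
      generalize ((n + 1 : ℝ) : ℂ) ^ (1 - s) = a
      generalize ((n + 2 : ℝ) : ℂ) ^ (1 - s) = b
      generalize ((n + 1 : ℝ) : ℂ) ^ (-s) = c
      rw [h12]
      field_simp
      ring
    rw [e] at key
    refine key.trans (le_of_eq ?_)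
    norm_num
  · intro y hy
    have hy0 : y ≠ 0 := by
      have h0 := hy.1
      have h00 : (0 : ℝ) ≤ n := Nat.cast_nonneg n
      linarith
    have h1 := (hasDerivAt_ofReal_cpow_const (r := 1 - s) hy0 hs0).div_const (1 - s)
    have h2 := (Complex.ofRealCLM.hasDerivAt (x := y)).const_mul (((n + 1 : ℝ) : ℂ) ^ (-s))
    refine HasDerivAt.hasDerivWithinAt ?_
    have e3 : ((n + 1 : ℝ) : ℂ) ^ (-s) - (y : ℂ) ^ (-s) =
        ((n + 1 : ℝ) : ℂ) ^ (-s) * Complex.ofRealCLM 1 - (1 - s) * (y : ℂ) ^ (1 - s - 1) / (1 - s) := by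
      rw [mul_div_cancel_left₀ _ hs0, show 1 - s - 1 = -s by ring]
      simp
    rw [e3]
    exact h2.sub h1
  · intro y hy
    exact h y hy.1 hy.2

lemma zterm_bound {n : ℕ} {s : ℂ} (hs1 : s ≠ 1) (hs : 1 - 1 / 80 < s.re) :
    ‖zterm n s‖ ≤ 2 * ‖s‖ ^ (1 / 40 : ℝ) * (n + 1 : ℝ) ^ (-(1 + 1 / 80) : ℝ) := by
  have hs0 : 0 < s.re := by linarith
  set N : ℝ := n + 1 with hN
  have hN1 : 1 ≤ N := by simp [hN]
  have hN0 : 0 < N := by linarith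
  have hB1 : ‖zterm n s‖ ≤ ‖s‖ * N ^ (-s.re - 1) :=
    zterm_bound_of hs1 fun u h1 h2 => cpow_sub_bound hN1 h1 (by rw [hN]; linarith) hs0
  have hB2 : ‖zterm n s‖ ≤ 2 * N ^ (-s.re) :=
    zterm_bound_of hs1 fun u h1 h2 => cpow_sub_bound' hN1 h1 hs0
  have hsn : 0 < ‖s‖ := by
    refine norm_pos_iff.mpr ?_
    intro h; rw [h] at hs0; simp at hs0
  have hmain : ‖zterm n s‖ ≤ 2 * N ^ (-s.re) * (‖s‖ / N) ^ (1 / 40 : ℝ) := by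
    rcases le_total ‖s‖ N with h | h
    · have h1 : ‖s‖ / N ≤ (‖s‖ / N) ^ (1 / 40 : ℝ) := by
        have := Real.rpow_le_rpow_of_exponent_ge (x := ‖s‖ / N) (by positivity)
          ((div_le_one hN0).mpr h) (y := 1) (z := 1 / 40) (by norm_num)
        simpa using this
      have h2 : ‖s‖ * N ^ (-s.re - 1) = N ^ (-s.re) * (‖s‖ / N) := by
        rw [Real.rpow_sub_one hN0.ne']; ring
      rw [h2] at hB1
      have h3 : 0 < N ^ (-s.re) := by positivity
      have h4 : 0 < ‖s‖ / N := by positivity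
      nlinarith
    · have h1 : 1 ≤ (‖s‖ / N) ^ (1 / 40 : ℝ) :=
        Real.one_le_rpow ((one_le_div hN0).mpr h) (by norm_num)
      have h3 : 0 < N ^ (-s.re) := by positivity
      nlinarith
  refine hmain.trans ?_
  rw [Real.div_rpow hsn.le hN0.le]
  have h5 : N ^ (-s.re) / N ^ (1 / 40 : ℝ) ≤ N ^ (-(1 + 1 / 80) : ℝ) := by
    rw [← Real.rpow_sub hN0]
    exact Real.rpow_le_rpow_of_exponent_le hN1 (by linarith)
  calc 2 * N ^ (-s.re) * (‖s‖ ^ (1 / 40 : ℝ) / N ^ (1 / 40 : ℝ))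
      = 2 * ‖s‖ ^ (1 / 40 : ℝ) * (N ^ (-s.re) / N ^ (1 / 40 : ℝ)) := by ring
    _ ≤ _ := by gcongr

lemma summable_maj : Summable fun n : ℕ => (n + 1 : ℝ) ^ (-(1 + 1 / 80) : ℝ) := by
  have h := (summable_nat_add_iff 1).mpr
    (Real.summable_nat_rpow (p := -(1 + 1 / 80)).mpr (by norm_num))
  simpa using h

lemma summable_zterm {s : ℂ} (hs1 : s ≠ 1) (hs : 1 - 1 / 80 < s.re) :
    Summable fun n => zterm n s :=
  Summable.of_norm_bounded (summable_maj.mul_left _) fun _ => zterm_bound hs1 hs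

lemma tsum_zterm_of_one_lt {s : ℂ} (hs : 1 < s.re) :
    ∑' n, zterm n s = riemannZeta s - 1 / (s - 1) := by
  have hs1 : s ≠ 1 := by
    intro h; rw [h] at hs; simp at hs
  have hs0 : s - 1 ≠ 0 := sub_ne_zero.mpr hs1
  have hsum := summable_zterm hs1 (by linarith)
  have h1 : Summable fun n : ℕ => (1 : ℂ) / (n + 1 : ℂ) ^ s := by
    have := (summable_nat_add_iff 1).mpr (Complex.summable_one_div_nat_cpow.mpr hs)
    simpa using this
  have t1 := hsum.hasSum.tendsto_sum_nat
  have t2 := h1.hasSum.tendsto_sum_nat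
  rw [← zeta_eq_tsum_one_div_nat_add_one_cpow hs] at t2
  have t3 : Tendsto (fun N : ℕ => (1 - ((N + 1 : ℝ) : ℂ) ^ (1 - s)) / (s - 1)) atTop
      (𝓝 ((1 - 0) / (s - 1))) := by
    refine Tendsto.div_const (Tendsto.sub tendsto_const_nhds ?_) _
    rw [tendsto_zero_iff_norm_tendsto_zero]
    have h : ∀ N : ℕ, ‖((N + 1 : ℝ) : ℂ) ^ (1 - s)‖ = (N + 1 : ℝ) ^ (-(s.re - 1)) := by
      intro N
      rw [norm_cpow_eq_rpow_re_of_pos (by positivity)]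
      simp
    simp_rw [h]
    exact (tendsto_rpow_neg_atTop (by linarith)).comp
      (tendsto_atTop_add_const_right _ _ tendsto_natCast_atTop_atTop)
  have t4 := t2.sub t3
  rw [sub_zero] at t4
  refine tendsto_nhds_unique t1 (t4.congr ?_)
  intro N
  induction N with
  | zero => simp
  | succ k ih =>
    rw [Finset.sum_range_succ, Finset.sum_range_succ, ← ih]
    unfold zterm
    have e1 : (1 : ℂ) / (k + 1 : ℂ) ^ s = ((k + 1 : ℝ) : ℂ) ^ (-s) := by
      rw [cpow_neg]; push_cast; simp
    rw [e1]
    have e2 : (((k + 1 : ℕ) : ℝ) + 1) = (k : ℝ) + 2 := by push_cast; ring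
    rw [e2]
    ring

lemma tsum_zterm_eq {s : ℂ} (hs : 1 - 1 / 80 < s.re) (hs' : s.im ≠ 0) :
    ∑' n, zterm n s = riemannZeta s - 1 / (s - 1) := by
  set U : Set ℂ := ({z : ℂ | 1 - 1 / 80 < z.re} ∩ {z : ℂ | 0 < s.im * z.im}) ∩
    Metric.ball 0 (‖s‖ + 10) with hU
  have hUo : IsOpen U := by
    refine (IsOpen.inter ?_ ?_).inter Metric.isOpen_ball
    · exact isOpen_lt continuous_const continuous_re
    · exact isOpen_lt continuous_const (continuous_const.mul continuous_im)
  have hUc : Convex ℝ U := by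
    refine (Convex.inter ?_ ?_).inter (convex_ball _ _)
    · exact convex_halfSpace_re_gt _
    · exact convex_halfSpace_gt (f := fun z : ℂ => s.im * z.im)
        ⟨fun x y => by simp [mul_add], fun c x => by simp; ring⟩ 0
  have hU1 : ∀ z ∈ U, z ≠ 1 := by
    rintro z ⟨⟨_, h⟩, _⟩ rfl
    simp at h
  have hd1 : DifferentiableOn ℂ (fun z => ∑' n, zterm n z) U := by
    refine differentiableOn_tsum_of_summable_norm
      (summable_maj.mul_left (2 * (‖s‖ + 10) ^ (1 / 40 : ℝ))) ?_ hUo ?_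
    · intro n z hz
      have hz0 : z - 1 ≠ 0 := sub_ne_zero.mpr (hU1 z hz)
      have a1 : ((n + 1 : ℝ) : ℂ) ≠ 0 := by
        exact_mod_cast (by positivity : (n + 1 : ℝ) ≠ 0)
      have a2 : ((n + 2 : ℝ) : ℂ) ≠ 0 := by
        exact_mod_cast (by positivity : (n + 2 : ℝ) ≠ 0)
      refine DifferentiableAt.differentiableWithinAt ?_
      unfold zterm
      refine DifferentiableAt.sub ?_ (DifferentiableAt.div (DifferentiableAt.sub ?_ ?_) ?_ hz0)
      · exact (differentiableAt_id.neg).const_cpow (Or.inl a1)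
      · exact (differentiableAt_id.const_sub 1).const_cpow (Or.inl a1)
      · exact (differentiableAt_id.const_sub 1).const_cpow (Or.inl a2)
      · exact differentiableAt_id.sub_const 1
    · intro n z hz
      refine (zterm_bound (hU1 z hz) hz.1.1).trans ?_
      have : ‖z‖ ≤ ‖s‖ + 10 := by
        have := hz.2
        rw [mem_ball_zero_iff] at this
        exact this.le
      gcongr
  have hd2 : DifferentiableOn ℂ (fun z => riemannZeta z - 1 / (z - 1)) U := by
    intro z hz
    have hz0 : z - 1 ≠ 0 := sub_ne_zero.mpr (hU1 z hz)
    refine DifferentiableAt.differentiableWithinAt ?_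
    exact (differentiableAt_riemannZeta (hU1 z hz)).sub
      ((differentiableAt_const _).div (differentiableAt_id.sub_const 1) hz0)
  have hsU : s ∈ U := by
    refine ⟨⟨hs, ?_⟩, ?_⟩
    · exact mul_self_pos.mpr hs'
    · rw [mem_ball_zero_iff]; linarith
  have hz0U : (⟨2, s.im⟩ : ℂ) ∈ U := by
    refine ⟨⟨?_, ?_⟩, ?_⟩
    · show (1 - 1 / 80 : ℝ) < 2
      norm_num
    · exact mul_self_pos.mpr hs'
    · rw [mem_ball_zero_iff]
      refine (norm_le_abs_re_add_abs_im _).trans_lt ?_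
      have := abs_im_le_norm s
      simp
      linarith
  refine AnalyticOnNhd.eqOn_of_preconnected_of_eventuallyEq (hd1.analyticOnNhd hUo)
    (hd2.analyticOnNhd hUo) hUc.isPreconnected hz0U ?_ hsU
  have : {z : ℂ | 1 < z.re} ∈ 𝓝 (⟨2, s.im⟩ : ℂ) :=
    (isOpen_lt continuous_const continuous_re).mem_nhds (by show (1 : ℝ) < 2; norm_num)
  filter_upwards [this] with z hz
  exact tsum_zterm_of_one_lt hz

theorem zeta_upper : ∃ C : ℝ, 0 < C ∧ ∀ s : ℂ, 1 - 1 / 80 < s.re → (1 < s.re ∨ s.im ≠ 0) →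
    ‖riemannZeta s - 1 / (s - 1)‖ ≤ C * ‖s‖ ^ (1 / 40 : ℝ) := by
  refine ⟨2 * (∑' n : ℕ, (n + 1 : ℝ) ^ (-(1 + 1 / 80) : ℝ)) + 1, ?_, ?_⟩
  · have : 0 ≤ ∑' n : ℕ, (n + 1 : ℝ) ^ (-(1 + 1 / 80) : ℝ) := tsum_nonneg fun n => by positivity
    linarith
  · intro s hs h
    have hs1 : s ≠ 1 := by
      rintro rfl
      simp at h
    have e : ∑' n, zterm n s = riemannZeta s - 1 / (s - 1) := by
      rcases h with h | h
      · exact tsum_zterm_of_one_lt h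
      · exact tsum_zterm_eq hs h
    rw [← e]
    have := tsum_of_norm_bounded (f := fun n => zterm n s)
      ((summable_maj.mul_left (2 * ‖s‖ ^ (1 / 40 : ℝ))).hasSum) (fun n => zterm_bound hs1 hs)
    refine this.trans ?_
    rw [tsum_mul_left]
    have : 0 ≤ ‖s‖ ^ (1 / 40 : ℝ) := by positivity
    nlinarith

end PNT

namespace PNT
open Complex Filter Topology

lemma norm_rpow_le {s : ℂ} {q : ℝ} (hq : 1 ≤ q) (hre : |s.re| ≤ 3) (him : |s.im| ≤ 4 * q ^ 40) :
    ‖s‖ ^ (1 / 40 : ℝ) ≤ 7 * q := by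
  have hq40 : 1 ≤ q ^ 40 := one_le_pow₀ hq
  have h1 : ‖s‖ ≤ (7 * q) ^ (40 : ℕ) := by
    have h2 := norm_le_abs_re_add_abs_im s
    have h3 : (7 * q) ^ 40 = 7 ^ 40 * q ^ 40 := mul_pow _ _ _
    rw [h3]
    have : (7 : ℝ) * q ^ 40 ≤ 7 ^ 40 * q ^ 40 := by gcongr; norm_num
    linarith
  calc ‖s‖ ^ (1 / 40 : ℝ) ≤ ((7 * q) ^ (40 : ℕ)) ^ (1 / 40 : ℝ) := by gcongr
    _ = 7 * q := by
      rw [← Real.rpow_natCast, ← Real.rpow_mul (by positivity)]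
      norm_num

lemma zeta_b : ∃ C : ℝ, 1 ≤ C ∧ ∀ s : ℂ, ∀ q : ℝ, 1 ≤ q → 1 - 1 / 80 < s.re → s.re ≤ 3 →
    1 ≤ |s.im| → |s.im| ≤ 4 * q ^ 40 → ‖riemannZeta s‖ ≤ C * q := by
  obtain ⟨C, hC, h⟩ := zeta_upper
  refine ⟨7 * C + 1, by linarith, ?_⟩
  intro s q hq h1 h2 h3 h4
  have him : s.im ≠ 0 := by
    intro h0; rw [h0] at h3; norm_num at h3
  have e := h s h1 (Or.inr him)
  have e2 := norm_rpow_le (s := s) hq (by rw [abs_le]; constructor <;> linarith) h4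
  have e3 : ‖1 / (s - 1)‖ ≤ 1 := by
    rw [norm_div, norm_one]
    have : 1 ≤ ‖s - 1‖ := by
      have := abs_im_le_norm (s - 1)
      simp at this
      linarith
    exact (div_le_one (by linarith)).mpr this
  have e4 : ‖riemannZeta s‖ ≤ ‖riemannZeta s - 1 / (s - 1)‖ + ‖1 / (s - 1)‖ := by
    have := norm_add_le (riemannZeta s - 1 / (s - 1)) (1 / (s - 1))
    simpa using this
  have e5 : C * ‖s‖ ^ (1 / 40 : ℝ) ≤ C * (7 * q) := by gcongr
  nlinarith

lemma zeta_real_b : ∃ C : ℝ, 1 ≤ C ∧ ∀ x : ℝ, 0 < x → x ≤ 1 → ‖riemannZeta (1 + x)‖ ≤ C / x := by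
  obtain ⟨C, hC, h⟩ := zeta_upper
  refine ⟨7 * C + 1, by linarith, ?_⟩
  intro x h1 h2
  have e := h (1 + x) (by simp; linarith) (Or.inl (by simp; linarith))
  have e2 := norm_rpow_le (s := 1 + x) (q := 1) le_rfl
    (by simp; rw [abs_le]; constructor <;> linarith) (by simp)
  have e3 : ‖1 / ((1 + x : ℂ) - 1)‖ = 1 / x := by
    simp [abs_of_pos h1]
  have e4 : ‖riemannZeta (1 + x)‖ ≤ ‖riemannZeta (1 + x) - 1 / ((1 + x : ℂ) - 1)‖ +
      ‖1 / ((1 + x : ℂ) - 1)‖ := by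
    have := norm_add_le (riemannZeta (1 + x) - 1 / ((1 + x : ℂ) - 1)) (1 / ((1 + x : ℂ) - 1))
    simpa using this
  rw [e3] at e4
  have e5 : C * ‖(1 + x : ℂ)‖ ^ (1 / 40 : ℝ) ≤ C * (7 * 1) := by gcongr
  have e6 : 1 ≤ 1 / x := by rw [le_div_iff₀ h1]; linarith
  calc ‖riemannZeta (1 + x)‖ ≤ 7 * C * 1 + 1 / x := by linarith
    _ ≤ 7 * C * (1 / x) + 1 / x := by gcongr
    _ = _ := by ring

lemma zeta_deriv_b : ∃ C : ℝ, 1 ≤ C ∧ ∀ s : ℂ, ∀ q : ℝ, 1 ≤ q → 1 - 1 / 200 ≤ s.re → s.re ≤ 5 / 2 →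
    2 ≤ |s.im| → |s.im| ≤ 3 * q ^ 40 → ‖deriv riemannZeta s‖ ≤ C * q := by
  obtain ⟨C, hC, h⟩ := zeta_b
  refine ⟨200 * C, by linarith, ?_⟩
  intro s q hq h1 h2 h3 h4
  have hq40 : 1 ≤ q ^ 40 := one_le_pow₀ hq
  have hball : ∀ z ∈ Metric.closedBall s (1 / 200), |z.re - s.re| ≤ 1 / 200 ∧ |z.im - s.im| ≤ 1 / 200 := by
    intro z hz
    rw [mem_closedBall_iff_norm] at hz
    have a := abs_re_le_norm (z - s)
    have b := abs_im_le_norm (z - s)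
    simp only [sub_re, sub_im] at a b
    exact ⟨a.trans hz, b.trans hz⟩
  have him : ∀ z ∈ Metric.closedBall s (1 / 200), |s.im| - 1 / 200 ≤ |z.im| ∧
      |z.im| ≤ |s.im| + 1 / 200 := by
    intro z hz
    have := (hball z hz).2
    have a := abs_sub_abs_le_abs_sub z.im s.im
    have b := abs_sub_abs_le_abs_sub s.im z.im
    rw [abs_sub_comm] at b
    constructor <;> linarith
  have key := norm_deriv_le_of_forall_mem_sphere_norm_le (c := s) (R := 1 / 200) (C := C * q)
    (f := riemannZeta) (by norm_num) ?_ ?_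
  · refine key.trans (le_of_eq ?_); ring
  · apply DifferentiableOn.diffContOnCl_ball (U := Metric.closedBall s (1 / 200)) _ le_rfl
    intro z hz
    refine (differentiableAt_riemannZeta ?_).differentiableWithinAt
    rintro rfl
    have := (him 1 hz).1
    simp at this
    linarith
  · intro z hz
    have hz' := Metric.sphere_subset_closedBall hz
    have a := abs_le.mp (hball z hz').1
    have b := him z hz'
    exact h z q hq (by linarith) (by linarith) (by linarith) (by linarith)

lemma zeta_341 : ∃ C : ℝ, 1 ≤ C ∧ ∀ x t q : ℝ, 1 ≤ q → 0 < x → x ≤ 1 → 2 ≤ |t| → |t| ≤ 2 * q ^ 40 →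
    x ^ 3 ≤ C * q * ‖riemannZeta (1 + x + I * t)‖ ^ 4 := by
  obtain ⟨C, hC, h⟩ := zeta_b
  obtain ⟨D, hD, hr⟩ := zeta_real_b
  refine ⟨D ^ 3 * C, by
    have := one_le_pow₀ hD (n := 3)
    nlinarith, ?_⟩
  intro x t q hq hx hx1 ht ht'
  have key := DirichletCharacter.norm_LFunction_product_ge_one (N := 1) 1 hx t
  rw [DirichletCharacter.LFunctionTrivChar, DirichletCharacter.LFunction_modOne_eq,
    DirichletCharacter.LFunction_modOne_eq, norm_mul, norm_mul, norm_pow, norm_pow] at key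
  have h1 := hr x hx hx1
  have h2 := h (1 + x + 2 * I * t) q hq (by simp; linarith) (by simp; linarith)
    (by simp [abs_mul]; linarith) (by simp [abs_mul]; linarith)
  have h3 : 1 ≤ (D / x) ^ 3 * ‖riemannZeta (1 + x + I * t)‖ ^ 4 * (C * q) := by
    refine key.le.trans ?_
    gcongr
  rw [div_pow] at h3
  have hx3 : 0 < x ^ 3 := by positivity
  calc x ^ 3 = x ^ 3 * 1 := by ring
    _ ≤ x ^ 3 * (D ^ 3 / x ^ 3 * ‖riemannZeta (1 + x + I * t)‖ ^ 4 * (C * q)) := by gcongr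
    _ = D ^ 3 * C * q * ‖riemannZeta (1 + x + I * t)‖ ^ 4 := by field_simp

lemma zeta_lower : ∃ C κ : ℝ, 1 ≤ C ∧ 0 < κ ∧ κ ≤ 1 / 100 ∧ ∀ σ t q : ℝ, 1 ≤ q → |t| = q ^ 40 → 4 ≤ |t| →
    1 < σ → σ ≤ 2 → ∀ z ∈ Metric.closedBall (σ + I * t : ℂ) (κ ^ 4 / q ^ 8),
    1 / q ^ 7 ≤ C * ‖riemannZeta z‖ ∧ ‖deriv riemannZeta z‖ ≤ C * q ∧ q ^ 40 / 2 ≤ |z.im| ∧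
      1 / 2 ≤ z.re := by
  obtain ⟨C1, hC1, h1⟩ := zeta_deriv_b
  obtain ⟨C2, hC2, h2⟩ := zeta_341
  obtain ⟨C, hC5, hCC1, hCC2⟩ : ∃ C : ℝ, 5 ≤ C ∧ C1 ≤ C ∧ C2 ≤ C :=
    ⟨max 5 (max C1 C2), by simp, by simp, by simp⟩
  have hC0 : 0 < C := by linarith
  set κ : ℝ := 1 / (4 * C ^ 2) with hκ
  have hκ0 : 0 < κ := by positivity
  have hκ1 : κ ≤ 1 / 100 := by
    rw [hκ]
    apply one_div_le_one_div_of_le (by norm_num)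
    nlinarith
  refine ⟨max C (2 * C / κ ^ 3), κ, by simp; left; linarith, hκ0, hκ1, ?_⟩
  intro σ t q hq ht ht4 hσ1 hσ2 z hz
  have hq0 : 0 < q := by linarith
  have hq40 : 1 ≤ q ^ 40 := one_le_pow₀ hq
  have hq8 : 1 ≤ q ^ 8 := one_le_pow₀ hq
  set r : ℝ := κ ^ 4 / q ^ 8 with hr
  have hr0 : 0 < r := by positivity
  have hr1 : r ≤ 1 / 400 := by
    calc r ≤ κ ^ 4 := div_le_self (by positivity) hq8
      _ ≤ (1 / 100) ^ 4 := by gcongr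
      _ ≤ 1 / 400 := by norm_num
  set x : ℝ := max (σ - 1) r with hx
  have hxr : r ≤ x := le_max_right _ _
  have hxσ : σ - 1 ≤ x := le_max_left _ _
  have hx1 : x ≤ 1 := max_le (by linarith) (by linarith)
  have hxσ' : x ≤ σ - 1 + r := max_le (by linarith) (by linarith)
  set s1 : ℂ := 1 + x + I * t with hs1
  have hdist : ‖(σ + I * t : ℂ) - s1‖ ≤ r := by
    have : (σ + I * t : ℂ) - s1 = ((σ - 1 - x : ℝ) : ℂ) := by rw [hs1]; push_cast; ring
    rw [this, norm_real, Real.norm_eq_abs, abs_le]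
    constructor <;> linarith
  have hzB : z ∈ Metric.closedBall s1 (2 * r) := by
    rw [mem_closedBall_iff_norm] at hz ⊢
    calc ‖z - s1‖ = ‖(z - (σ + I * t : ℂ)) + ((σ + I * t : ℂ) - s1)‖ := by congr 1; ring
      _ ≤ _ := norm_add_le _ _
      _ ≤ _ := by linarith
  have hB : ∀ w ∈ Metric.closedBall s1 (2 * r), 1 - 1 / 200 ≤ w.re ∧ w.re ≤ 5 / 2 ∧
      |t| - 1 / 200 ≤ |w.im| ∧ |w.im| ≤ |t| + 1 / 200 := by
    intro w hw
    rw [mem_closedBall_iff_norm] at hw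
    have a := (abs_re_le_norm (w - s1)).trans hw
    have b := (abs_im_le_norm (w - s1)).trans hw
    simp [hs1] at a b
    have a' := abs_le.mp a
    have b1 := abs_sub_abs_le_abs_sub w.im t
    have b2 := abs_sub_abs_le_abs_sub t w.im
    rw [abs_sub_comm] at b2
    refine ⟨by linarith, by linarith, by linarith, by linarith⟩
  have hder : ∀ w ∈ Metric.closedBall s1 (2 * r), ‖deriv riemannZeta w‖ ≤ C * q := by
    intro w hw
    obtain ⟨a, b, c, d⟩ := hB w hw
    refine (h1 w q hq a b (by linarith) (by linarith)).trans ?_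
    gcongr
  have hs1B : s1 ∈ Metric.closedBall s1 (2 * r) := Metric.mem_closedBall_self (by linarith)
  have hdiff : ‖riemannZeta s1 - riemannZeta z‖ ≤ C * q * (2 * r) := by
    have := Convex.norm_image_sub_le_of_norm_deriv_le (𝕜 := ℂ) (f := riemannZeta)
      (s := Metric.closedBall s1 (2 * r)) (x := z) (y := s1) (C := C * q) ?_ hder
      (convex_closedBall _ _) hzB hs1B
    · refine this.trans ?_
      gcongr
      rw [mem_closedBall_iff_norm] at hzB
      rwa [norm_sub_rev]
    · intro w hw
      apply differentiableAt_riemannZeta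
      rintro rfl
      have := (hB 1 hw).2.2.1
      simp at this
      linarith
  have hlow : κ ^ 3 / (C * q ^ 7) ≤ ‖riemannZeta s1‖ := by
    have e := h2 x t q hq (by linarith) hx1 (by linarith) (by linarith)
    rw [← hs1] at e
    have e1 : r ^ 3 ≤ C * q * ‖riemannZeta s1‖ ^ 4 := by
      calc r ^ 3 ≤ x ^ 3 := by gcongr
        _ ≤ _ := e
        _ ≤ _ := by gcongr
    have e2 : (κ ^ 3 / (C * q ^ 7)) ^ 4 ≤ ‖riemannZeta s1‖ ^ 4 := by
      have e3 : r ^ 3 / (C * q) ≤ ‖riemannZeta s1‖ ^ 4 := by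
        rw [div_le_iff₀ (by positivity)]; linarith
      refine le_trans ?_ e3
      have : r ^ 3 / (C * q) = κ ^ 12 / (C * q ^ 25) := by
        rw [hr]; field_simp
      rw [this, div_pow, ← pow_mul]
      rw [mul_pow, ← pow_mul]
      norm_num
      have hC1' : 1 ≤ C := by linarith
      have f1 : C ≤ C ^ 4 := le_self_pow₀ hC1' (by norm_num)
      have f2 : q ^ 25 ≤ q ^ 28 := pow_le_pow_right₀ hq (by norm_num)
      gcongr
    exact le_of_pow_le_pow_left₀ (by norm_num) (norm_nonneg _) e2
  have hcalc : C * q * (2 * r) = κ ^ 3 / (2 * C * q ^ 7) := by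
    have : r = κ ^ 3 * κ / q ^ 8 := by rw [hr]; ring
    rw [this, hκ]; field_simp; norm_num
  have hz1 : κ ^ 3 / (2 * C * q ^ 7) ≤ ‖riemannZeta z‖ := by
    have a : ‖riemannZeta s1‖ ≤ ‖riemannZeta s1 - riemannZeta z‖ + ‖riemannZeta z‖ := by
      have := norm_add_le (riemannZeta s1 - riemannZeta z) (riemannZeta z)
      simpa using this
    have b : κ ^ 3 / (C * q ^ 7) = κ ^ 3 / (2 * C * q ^ 7) + κ ^ 3 / (2 * C * q ^ 7) := by
      field_simp; norm_num
    linarith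
  obtain ⟨a, b, c, d⟩ := hB z hzB
  refine ⟨?_, ?_, by linarith, by linarith⟩
  · calc 1 / q ^ 7 = (2 * C / κ ^ 3) * (κ ^ 3 / (2 * C * q ^ 7)) := by field_simp
      _ ≤ (2 * C / κ ^ 3) * ‖riemannZeta z‖ := by gcongr
      _ ≤ _ := by gcongr; exact le_max_right _ _
  · refine (hder z hzB).trans ?_
    gcongr
    exact le_max_left _ _

end PNT

namespace PNT
open Complex Filter Topology

/-- `(s-1)ζ(s)`, as an entire function. -/
noncomputable def Z : ℂ → ℂ := DirichletCharacter.LFunctionTrivChar₁ 1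

lemma Z_diff : Differentiable ℂ Z := DirichletCharacter.differentiable_LFunctionTrivChar₁ 1

lemma Z_of_ne {s : ℂ} (hs : s ≠ 1) : Z s = (s - 1) * riemannZeta s := by
  unfold Z
  rw [DirichletCharacter.LFunctionTrivChar₁, Function.update_of_ne hs,
    DirichletCharacter.LFunctionTrivChar, DirichletCharacter.LFunction_modOne_eq]

lemma Z_deriv_of_ne {s : ℂ} (hs : s ≠ 1) :
    deriv Z s = (s - 1) * deriv riemannZeta s + riemannZeta s := by
  unfold Z
  rw [DirichletCharacter.deriv_LFunctionTrivChar₁_apply_of_ne_one _ hs,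
    DirichletCharacter.LFunctionTrivChar, DirichletCharacter.LFunction_modOne_eq]

lemma Z_ne_zero {s : ℂ} (hs : 1 ≤ s.re) : Z s ≠ 0 := by
  rcases eq_or_ne s 1 with rfl | h
  · exact DirichletCharacter.LFunctionTrivChar₁_apply_one_ne_zero 1
  · rw [Z_of_ne h]
    exact mul_ne_zero (sub_ne_zero.mpr h) (riemannZeta_ne_zero_of_one_le_re hs)

/-- The logarithmic derivative of zeta over s, minus the pole, continued analytically. -/
noncomputable def F (s : ℂ) : ℂ := -(deriv Z s / Z s + 1) / s

lemma F_eq {s : ℂ} (hs : s ≠ 1) (hz : riemannZeta s ≠ 0) :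
    F s = -(deriv riemannZeta s / riemannZeta s + 1 / (s - 1) + 1) / s := by
  have : s - 1 ≠ 0 := sub_ne_zero.mpr hs
  unfold F
  rw [Z_of_ne hs, Z_deriv_of_ne hs]
  congr 3
  field_simp

lemma F_diffAt {s : ℂ} (hs : s ≠ 0) (hz : Z s ≠ 0) : DifferentiableAt ℂ F s := by
  unfold F
  have h1 : DifferentiableAt ℂ (deriv Z) s := (Z_diff.analyticAt s).deriv.differentiableAt
  exact ((((h1.div (Z_diff s) hz)).add_const 1).neg).div differentiableAt_id hs

lemma F_small (T : ℝ) : ∃ C : ℝ, ∀ σ t : ℝ, 1 < σ → σ ≤ 2 → |t| ≤ T →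
    ‖iteratedDeriv 2 F (σ + I * t)‖ ≤ C := by
  have hU : IsOpen {s : ℂ | s ≠ 0 ∧ Z s ≠ 0} :=
    isOpen_ne.inter (isOpen_ne.preimage Z_diff.continuous)
  have hF : DifferentiableOn ℂ F {s : ℂ | s ≠ 0 ∧ Z s ≠ 0} :=
    fun s hs => (F_diffAt hs.1 hs.2).differentiableWithinAt
  have hA := hF.analyticOnNhd hU
  have hc : ContinuousOn (iteratedDeriv 2 F) {s : ℂ | s ≠ 0 ∧ Z s ≠ 0} := by
    intro s hs
    rw [iteratedDeriv_eq_iterate]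
    exact ((hA s hs).iterated_deriv 2).continuousAt.continuousWithinAt
  have hK : IsCompact (Set.Icc (1 : ℝ) 2 ×ℂ Set.Icc (-T) T) := isCompact_Icc.reProdIm isCompact_Icc
  have hsub : (Set.Icc (1 : ℝ) 2 ×ℂ Set.Icc (-T) T) ⊆ {s : ℂ | s ≠ 0 ∧ Z s ≠ 0} := by
    intro s hs
    rw [mem_reProdIm] at hs
    refine ⟨?_, Z_ne_zero hs.1.1⟩
    rintro rfl
    have := hs.1.1
    norm_num at this
  obtain ⟨C, hC⟩ := hK.exists_bound_of_continuousOn (hc.mono hsub)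
  refine ⟨C, fun σ t h1 h2 h3 => hC _ ?_⟩
  rw [mem_reProdIm]
  have := abs_le.mp h3
  simp
  exact ⟨⟨h1.le, h2⟩, this⟩

lemma F_large : ∃ C : ℝ, 0 < C ∧ ∀ σ t : ℝ, 1 < σ → σ ≤ 2 → 4 ≤ |t| →
    ‖iteratedDeriv 2 F (σ + I * t)‖ ≤ C / |t| ^ (2 / 5 : ℝ) := by
  obtain ⟨C, κ, hC, hκ0, hκ1, h⟩ := zeta_lower
  refine ⟨2 * (2 * (C ^ 2 + 2)) / (κ ^ 4) ^ 2, by positivity, ?_⟩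
  intro σ t hσ1 hσ2 ht
  set q : ℝ := |t| ^ (1 / 40 : ℝ) with hq
  have hq1 : 1 ≤ q := Real.one_le_rpow (by linarith) (by norm_num)
  have hq0 : 0 < q := by linarith
  have hq40 : |t| = q ^ 40 := by
    rw [hq, ← Real.rpow_natCast, ← Real.rpow_mul (by positivity)]
    norm_num
  have hq16 : |t| ^ (2 / 5 : ℝ) = q ^ 16 := by
    rw [hq, ← Real.rpow_natCast, ← Real.rpow_mul (by positivity)]
    norm_num
  set r : ℝ := κ ^ 4 / q ^ 8 with hr
  have hr0 : 0 < r := by positivity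
  have hB := h σ t q hq1 hq40 ht hσ1 hσ2
  have hne : ∀ z ∈ Metric.closedBall (σ + I * t : ℂ) r, z ≠ 1 ∧ riemannZeta z ≠ 0 ∧ z ≠ 0 ∧
      2 ≤ |z.im| := by
    intro z hz
    obtain ⟨a, b, c, d⟩ := hB z hz
    refine ⟨?_, ?_, ?_, by linarith⟩
    · rintro rfl
      simp at c; linarith
    · intro h0
      rw [h0, norm_zero, mul_zero] at a
      have : 0 < 1 / q ^ 7 := by positivity
      linarith
    · rintro rfl
      norm_num at d
  have key := norm_iteratedDeriv_le_of_forall_mem_sphere_norm_le (c := (σ + I * t : ℂ)) (R := r)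
    (C := 2 * (C ^ 2 + 2) * q ^ 8 / q ^ 40) (f := F) 2 hr0 ?_ ?_
  · refine key.trans (le_of_eq ?_)
    rw [hq16, hr]
    norm_num
    field_simp
  · apply DifferentiableOn.diffContOnCl_ball (U := Metric.closedBall (σ + I * t : ℂ) r) _ le_rfl
    intro z hz
    obtain ⟨a, b, c, d⟩ := hne z hz
    refine (F_diffAt c ?_).differentiableWithinAt
    rw [Z_of_ne a]
    exact mul_ne_zero (sub_ne_zero.mpr a) b
  · intro z hz
    have hz' := Metric.sphere_subset_closedBall hz
    obtain ⟨a, b, c, d⟩ := hne z hz'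
    obtain ⟨a', b', c', d'⟩ := hB z hz'
    rw [F_eq a b, norm_div, norm_neg]
    have hζ : 0 < ‖riemannZeta z‖ := norm_pos_iff.mpr b
    have e1 : ‖deriv riemannZeta z / riemannZeta z‖ ≤ C ^ 2 * q ^ 8 := by
      rw [norm_div, div_le_iff₀ hζ]
      have : 1 ≤ C * ‖riemannZeta z‖ * q ^ 7 := by
        rwa [div_le_iff₀ (by positivity)] at a'
      calc ‖deriv riemannZeta z‖ ≤ C * q * 1 := by linarith
        _ ≤ C * q * (C * ‖riemannZeta z‖ * q ^ 7) := by gcongr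
        _ = _ := by ring
    have e2 : ‖1 / (z - 1)‖ ≤ 1 := by
      rw [norm_div, norm_one]
      have : 1 ≤ ‖z - 1‖ := by
        have := abs_im_le_norm (z - 1)
        simp at this
        linarith
      exact (div_le_one (by linarith)).mpr this
    have e3 : ‖deriv riemannZeta z / riemannZeta z + 1 / (z - 1) + 1‖ ≤ (C ^ 2 + 2) * q ^ 8 := by
      refine (norm_add₃_le).trans ?_
      rw [norm_one]
      have : 1 ≤ q ^ 8 := one_le_pow₀ hq1
      nlinarith
    have e4 : q ^ 40 / 2 ≤ ‖z‖ := c'.trans (abs_im_le_norm z)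
    calc _ ≤ (C ^ 2 + 2) * q ^ 8 / (q ^ 40 / 2) := by gcongr
      _ = _ := by field_simp

theorem F_bound : ∃ C : ℝ, 0 < C ∧ ∀ σ t : ℝ, 1 < σ → σ ≤ 2 →
    ‖iteratedDeriv 2 F (σ + I * t)‖ ≤ C / (1 + |t| ^ (2 / 5 : ℝ)) := by
  obtain ⟨C1, h1⟩ := F_small 4
  obtain ⟨C2, hC2, h2⟩ := F_large
  refine ⟨max (5 * max C1 1) (2 * C2), by positivity, ?_⟩
  intro σ t hσ hσ2
  have h0 : 0 ≤ |t| ^ (2 / 5 : ℝ) := by positivity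
  rcases le_total |t| 4 with h | h
  · have a := h1 σ t hσ hσ2 h
    have b : |t| ^ (2 / 5 : ℝ) ≤ 4 := by
      calc |t| ^ (2 / 5 : ℝ) ≤ 4 ^ (2 / 5 : ℝ) := by gcongr
        _ ≤ 4 ^ (1 : ℝ) := Real.rpow_le_rpow_of_exponent_le (by norm_num) (by norm_num)
        _ = 4 := by norm_num
    rw [le_div_iff₀ (by positivity)]
    calc _ ≤ max C1 1 * (1 + 4) := by
          gcongr
          exact a.trans (le_max_left _ _)
      _ ≤ _ := by
        have := le_max_left (5 * max C1 1) (2 * C2)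
        linarith
  · have a := h2 σ t hσ hσ2 h
    have b : 1 ≤ |t| ^ (2 / 5 : ℝ) := Real.one_le_rpow (by linarith) (by norm_num)
    refine a.trans ?_
    rw [div_le_div_iff₀ (by positivity) (by positivity)]
    have := le_max_right (5 * max C1 1) (2 * C2)
    calc C2 * (1 + |t| ^ (2 / 5 : ℝ)) ≤ (2 * C2) * |t| ^ (2 / 5 : ℝ) := by nlinarith
      _ ≤ _ := by gcongr

end PNT

namespace PNT
open Complex Filter Topology MeasureTheory

/-- The normalised error term `ψ(x)/x - 1`, cut off below `1`. -/
noncomputable def H (x : ℝ) : ℂ := Set.indicator (Set.Ioi 1) (fun x => ((Chebyshev.psi x / x - 1 : ℝ) : ℂ)) x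

lemma psi_div_le {x : ℝ} (hx : 1 < x) : 0 ≤ Chebyshev.psi x / x ∧ Chebyshev.psi x / x ≤ 6 := by
  have h1 := Chebyshev.psi_le_const_mul_self (x := x) (by linarith)
  have h2 := Chebyshev.psi_nonneg x
  have h3 : Real.log 4 < 2 := by
    have : Real.log 4 = 2 * Real.log 2 := by
      rw [← Real.log_rpow (by norm_num)]; norm_num
    rw [this]
    have := Real.log_two_lt_d9
    linarith
  refine ⟨by positivity, ?_⟩
  rw [div_le_iff₀ (by linarith)]
  nlinarith

lemma H_norm_le (x : ℝ) : ‖H x‖ ≤ 7 := by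
  unfold H
  by_cases hx : x ∈ Set.Ioi (1 : ℝ)
  · rw [Set.indicator_of_mem hx, norm_real, Real.norm_eq_abs, abs_le]
    have := psi_div_le hx
    constructor <;> linarith
  · rw [Set.indicator_of_notMem hx]; simp

lemma H_of_le {x : ℝ} (hx : x ≤ 1) : H x = 0 := by
  unfold H
  rw [Set.indicator_of_notMem]
  simpa using hx

lemma H_of_lt {x : ℝ} (hx : 1 < x) : H x = ((Chebyshev.psi x / x - 1 : ℝ) : ℂ) := by
  unfold H
  rw [Set.indicator_of_mem]
  exact hx

lemma H_meas : Measurable H := by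
  unfold H
  refine Measurable.indicator ?_ measurableSet_Ioi
  exact measurable_ofReal.comp ((Chebyshev.psi_mono.measurable.div measurable_id).sub_const 1)

lemma H_locInt : LocallyIntegrableOn H (Set.Ioi 0) := by
  apply LocallyIntegrable.locallyIntegrableOn
  have h7 : LocallyIntegrable (fun _ : ℝ => (7 : ℝ)) volume := locallyIntegrable_const 7
  exact h7.mono H_meas.aestronglyMeasurable (Eventually.of_forall fun x => by
    simpa using H_norm_le x)

lemma mellin_H {s : ℂ} (hs : 1 < s.re) : mellin H (1 - s) = F s := by
  have hs1 : s ≠ 1 := by rintro rfl; simp at hs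
  have hs0 : s ≠ 0 := by rintro rfl; norm_num at hs
  have hs10 : s - 1 ≠ 0 := sub_ne_zero.mpr hs1
  have hζ := riemannZeta_ne_zero_of_one_le_re hs.le
  have h1 : mellin H (1 - s) = ∫ x in Set.Ioi (1 : ℝ),
      ((Chebyshev.psi x : ℂ) * (x : ℂ) ^ (-(s + 1)) - (x : ℂ) ^ (-s)) := by
    unfold mellin H
    have e : ∀ x : ℝ, (x : ℂ) ^ (1 - s - 1) • Set.indicator (Set.Ioi 1)
        (fun x : ℝ => ((Chebyshev.psi x / x - 1 : ℝ) : ℂ)) x =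
        Set.indicator (Set.Ioi 1) (fun x : ℝ => (x : ℂ) ^ (-s) * ((Chebyshev.psi x / x - 1 : ℝ) : ℂ)) x := by
      intro x
      by_cases hx : x ∈ Set.Ioi (1 : ℝ)
      · rw [Set.indicator_of_mem hx, Set.indicator_of_mem hx, smul_eq_mul]
        congr 2; ring
      · rw [Set.indicator_of_notMem hx, Set.indicator_of_notMem hx, smul_zero]
    simp_rw [e]
    rw [setIntegral_indicator measurableSet_Ioi]
    rw [show Set.Ioi (0 : ℝ) ∩ Set.Ioi 1 = Set.Ioi 1 from
      Set.inter_eq_right.mpr (Set.Ioi_subset_Ioi zero_le_one)]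
    refine setIntegral_congr_fun measurableSet_Ioi ?_
    intro x hx
    have hx0 : (x : ℂ) ≠ 0 := by
      have : (1 : ℝ) < x := hx
      exact_mod_cast (by linarith : x ≠ 0)
    have : (x : ℂ) ^ (-(s + 1)) = (x : ℂ) ^ (-s) / x := by
      rw [show -(s + 1) = -s - 1 by ring, cpow_sub _ _ hx0, cpow_one]
    simp only [this]
    push_cast
    field_simp
  have hint2 : IntegrableOn (fun x : ℝ => (x : ℂ) ^ (-s)) (Set.Ioi 1) :=
    integrableOn_Ioi_cpow_of_lt (by simpa using hs) zero_lt_one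
  have hint1 : IntegrableOn (fun x : ℝ => (Chebyshev.psi x : ℂ) * (x : ℂ) ^ (-(s + 1))) (Set.Ioi 1) := by
    have hd : IntegrableOn (fun x : ℝ => 6 * ((x : ℂ) ^ (-s))) (Set.Ioi 1) := hint2.const_mul 6
    refine Integrable.mono hd ?_ ?_
    · refine AEStronglyMeasurable.mul ?_ ?_
      · exact (measurable_ofReal.comp Chebyshev.psi_mono.measurable).aestronglyMeasurable
      · refine ContinuousOn.aestronglyMeasurable ?_ measurableSet_Ioi
        intro x hx
        have : (1 : ℝ) < x := hx
        exact (continuousAt_ofReal_cpow_const x _ (Or.inr (by linarith))).continuousWithinAt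
    · refine (ae_restrict_iff' measurableSet_Ioi).mpr (Eventually.of_forall ?_)
      intro x hx
      have hx1 : (1 : ℝ) < x := hx
      have hx0 : 0 < x := by linarith
      rw [norm_mul, norm_mul, norm_cpow_eq_rpow_re_of_pos hx0, norm_cpow_eq_rpow_re_of_pos hx0, norm_real,
        Real.norm_eq_abs, abs_of_nonneg (Chebyshev.psi_nonneg x)]
      have e : (-(s + 1)).re = (-s).re - 1 := by simp; ring
      rw [e, Real.rpow_sub_one hx0.ne']
      have := (psi_div_le hx1).2
      calc Chebyshev.psi x * (x ^ (-s).re / x) = Chebyshev.psi x / x * x ^ (-s).re := by ring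
        _ ≤ 6 * x ^ (-s).re := by gcongr
        _ = _ := by norm_num
  rw [h1, integral_sub hint1 hint2, integral_Ioi_cpow_of_lt (by simpa using hs) zero_lt_one]
  have hL := ArithmeticFunction.LSeries_vonMangoldt_eq_deriv_riemannZeta_div hs
  have hpsi : ∀ n : ℕ, ∑ k ∈ Finset.Icc 1 n, ArithmeticFunction.vonMangoldt k = Chebyshev.psi n := by
    intro n
    unfold Chebyshev.psi
    rw [Nat.floor_natCast]
    rfl
  have hI := LSeries_eq_mul_integral_of_nonneg (fun n => ArithmeticFunction.vonMangoldt n) (r := 1)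
    zero_le_one hs ?_ (fun n => ArithmeticFunction.vonMangoldt_nonneg)
  · rw [hL] at hI
    have hI2 : ∫ (x : ℝ) in Set.Ioi 1, (Chebyshev.psi x : ℂ) * (x : ℂ) ^ (-(s + 1)) =
        -deriv riemannZeta s / riemannZeta s / s := by
      rw [hI, mul_div_cancel_left₀ _ hs0]
      refine setIntegral_congr_fun measurableSet_Ioi ?_
      intro x hx
      simp only
      rw [Chebyshev.psi_eq_psi_coe_floor, ← hpsi]
      push_cast
      rfl
    rw [hI2, F_eq hs1 hζ]
    have : -s + 1 ≠ 0 := by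
      intro h; apply hs10; linear_combination -h
    simp only [ofReal_one, one_cpow]
    field_simp
    ring
  · simp_rw [hpsi]
    refine Asymptotics.IsBigO.of_bound 6 ?_
    filter_upwards [eventually_gt_atTop 1] with n hn
    have hn1 : (1 : ℝ) < n := by exact_mod_cast hn
    have := (psi_div_le hn1).2
    rw [div_le_iff₀ (by linarith)] at this
    rw [Real.rpow_one, Real.norm_eq_abs, abs_of_nonneg (Chebyshev.psi_nonneg _), Real.norm_eq_abs,
      abs_of_nonneg (by linarith)]
    exact this

lemma isBigO_zero_of {f : ℝ → ℂ} (hf : ∀ x ≤ 1, f x = 0) (g : ℝ → ℝ) : f =O[𝓝[>] 0] g := by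
  have : f =ᶠ[𝓝[>] 0] fun _ => (0 : ℂ) := by
    have h1 : Set.Iio (1 : ℝ) ∈ 𝓝[>] (0 : ℝ) := mem_nhdsWithin_of_mem_nhds (Iio_mem_nhds one_pos)
    filter_upwards [h1] with x hx
    exact hf x (le_of_lt hx)
  exact this.trans_isBigO (Asymptotics.isBigO_zero _ _)

lemma logH_hasDeriv {s : ℂ} (hs : s.re < 0) :
    HasDerivAt (mellin H) (mellin (fun t => Real.log t • H t) s) s := by
  refine (mellin_hasDerivAt_of_isBigO_rpow (a := 0) (b := s.re - 1) H_locInt ?_ hs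
    (isBigO_zero_of (fun x => H_of_le) _) (by linarith)).2
  refine Asymptotics.IsBigO.of_bound 7 (Eventually.of_forall fun x => ?_)
  simpa using H_norm_le x

lemma log2H_hasDeriv {s : ℂ} (hs : s.re < 0) :
    HasDerivAt (mellin (fun t => Real.log t • H t))
      (mellin (fun t => Real.log t • Real.log t • H t) s) s := by
  refine (mellin_hasDerivAt_of_isBigO_rpow (a := s.re / 2) (b := s.re - 1) ?_ ?_ (by linarith)
    (isBigO_zero_of (fun x hx => by rw [H_of_le hx, smul_zero]) _) (by linarith)).2
  · refine LocallyIntegrableOn.continuousOn_smul isOpen_Ioi.isLocallyClosed H_locInt ?_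
    exact Real.continuousOn_log.mono (fun x hx => (ne_of_gt hx))
  · have h1 : H =O[atTop] fun _ : ℝ => (1 : ℝ) :=
      Asymptotics.IsBigO.of_bound 7 (Eventually.of_forall fun x => by simpa using H_norm_le x)
    have h2 := (isLittleO_log_rpow_atTop (r := -(s.re / 2)) (by linarith)).isBigO.smul h1
    simpa using h2

lemma iteratedDeriv_F {s : ℂ} (hs : 1 < s.re) :
    iteratedDeriv 2 F s = mellin (fun t => Real.log t • Real.log t • H t) (1 - s) := by
  have hopen : IsOpen {z : ℂ | 1 < z.re} := isOpen_lt continuous_const continuous_re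
  have hd1 : ∀ z : ℂ, 1 < z.re → deriv F z = -mellin (fun t => Real.log t • H t) (1 - z) := by
    intro z hz
    have e : F =ᶠ[𝓝 z] fun w => mellin H (1 - w) := by
      filter_upwards [hopen.mem_nhds hz] with w hw
      exact (mellin_H hw).symm
    rw [e.deriv_eq]
    have h := (logH_hasDeriv (s := 1 - z) (by simp; linarith)).comp z
      ((hasDerivAt_id z).const_sub 1)
    have := h.deriv
    simp only [mul_neg, mul_one] at this
    exact this
  rw [iteratedDeriv_succ, iteratedDeriv_one]
  have e : deriv F =ᶠ[𝓝 s] fun w => -mellin (fun t => Real.log t • H t) (1 - w) := by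
    filter_upwards [hopen.mem_nhds hs] with w hw
    exact hd1 w hw
  rw [e.deriv_eq]
  have h := ((log2H_hasDeriv (s := 1 - s) (by simp; linarith)).comp s
      ((hasDerivAt_id s).const_sub 1)).neg
  have := h.deriv
  simp only [mul_neg, mul_one, neg_neg] at this
  exact this

/-- The weighted error term in logarithmic coordinates. -/
noncomputable def w (a : ℝ) (u : ℝ) : ℂ := ((Real.exp (a * u) * u ^ 2 : ℝ) : ℂ) * H (Real.exp (-u))

lemma fourier_w {a : ℝ} (ha : 0 < a) (y : ℝ) :
    FourierTransform.fourier (w a) y = iteratedDeriv 2 F ((1 + a : ℝ) + I * ((-(2 * Real.pi * y) : ℝ) : ℂ)) := by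
  rw [iteratedDeriv_F (by simp; linarith), mellin_eq_fourier]
  have e1 : (1 - (((1 + a : ℝ) : ℂ) + I * ((-(2 * Real.pi * y) : ℝ) : ℂ))).re = -a := by
    simp
  have e2 : (1 - (((1 + a : ℝ) : ℂ) + I * ((-(2 * Real.pi * y) : ℝ) : ℂ))).im / (2 * Real.pi) = y := by
    have := Real.pi_pos
    simp
  rw [e1, e2]
  refine congrArg (fun f : ℝ → ℂ => FourierTransform.fourier f y) ?_
  funext u
  unfold w
  simp only [neg_neg, Real.log_exp, real_smul]
  push_cast
  ring

lemma w_integrable {a : ℝ} (ha : 0 < a) : Integrable (w a) := by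
  have hm : Measurable (w a) := by
    unfold w
    refine Measurable.mul ?_ (H_meas.comp (Real.measurable_exp.comp measurable_neg))
    refine measurable_ofReal.comp ?_
    fun_prop
  have hd : Integrable (Set.indicator (Set.Iic (0 : ℝ)) fun u => 7 * (16 / a ^ 2) * Real.exp (a / 2 * u)) := by
    rw [integrable_indicator_iff measurableSet_Iic]
    exact (integrableOn_exp_mul_Iic (by positivity) 0).const_mul _
  refine hd.mono hm.aestronglyMeasurable (Eventually.of_forall fun u => ?_)
  by_cases hu : u ≤ 0
  · rw [Set.indicator_of_mem (show u ∈ Set.Iic (0 : ℝ) from hu)]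
    unfold w
    rw [norm_mul, norm_real, Real.norm_of_nonneg (by positivity), Real.norm_of_nonneg (by positivity)]
    have h1 := H_norm_le (Real.exp (-u))
    have h2 : u ^ 2 * Real.exp (a * u) ≤ 16 / a ^ 2 * Real.exp (a / 2 * u) := by
      have h3 : Real.exp (a * u) = Real.exp (a / 2 * u) * Real.exp (a / 4 * u) ^ 2 := by
        rw [← Real.exp_nat_mul, ← Real.exp_add]; congr 1; push_cast; ring
      have h4 : (-(a / 4 * u)) * Real.exp (a / 4 * u) ≤ 1 := by
        have := Real.add_one_le_exp (-(a / 4 * u))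
        calc (-(a / 4 * u)) * Real.exp (a / 4 * u) ≤ Real.exp (-(a / 4 * u)) * Real.exp (a / 4 * u) := by
              gcongr; linarith
          _ = 1 := by rw [← Real.exp_add]; simp
      have h5 : 0 ≤ (-(a / 4 * u)) * Real.exp (a / 4 * u) := by
        have : 0 ≤ -(a / 4 * u) := by nlinarith
        positivity
      have h6 : ((-(a / 4 * u)) * Real.exp (a / 4 * u)) ^ 2 ≤ 1 := pow_le_one₀ h5 h4
      rw [h3]
      calc u ^ 2 * (Real.exp (a / 2 * u) * Real.exp (a / 4 * u) ^ 2)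
          = 16 / a ^ 2 * Real.exp (a / 2 * u) * ((-(a / 4 * u)) * Real.exp (a / 4 * u)) ^ 2 := by
            field_simp; ring
        _ ≤ 16 / a ^ 2 * Real.exp (a / 2 * u) * 1 := by gcongr
        _ = _ := by ring
    calc Real.exp (a * u) * u ^ 2 * ‖H (Real.exp (-u))‖ ≤ Real.exp (a * u) * u ^ 2 * 7 := by gcongr
      _ = 7 * (u ^ 2 * Real.exp (a * u)) := by ring
      _ ≤ 7 * (16 / a ^ 2 * Real.exp (a / 2 * u)) := by gcongr
      _ = _ := by ring
  · unfold w
    rw [H_of_le (by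
      rw [Real.exp_le_one_iff]; linarith [not_le.mp hu])]
    simp

end PNT

namespace PNT
open Complex Filter Topology MeasureTheory

lemma exists_test : ∃ (φ : ℝ → ℝ) (g : ℝ → ℂ), (∀ u, 0 ≤ φ u) ∧ (∀ u, |u| ≤ 1 / 2 → φ u = 1) ∧
    (∀ u, 1 ≤ |u| → φ u = 0) ∧ Continuous φ ∧ (∀ u, φ u ≤ 1) ∧ Integrable g ∧
    ∀ u, FourierTransform.fourier g u = (φ u : ℂ) := by
  let b : ContDiffBump (0 : ℝ) := ⟨1 / 2, 1, by norm_num, by norm_num⟩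
  have hc : HasCompactSupport (fun u : ℝ => ((b u : ℝ) : ℂ)) :=
    b.hasCompactSupport.comp_left (g := fun x : ℝ => (x : ℂ)) (by simp)
  have hs : ContDiff ℝ ((⊤ : ℕ∞) : WithTop ℕ∞) (fun u : ℝ => ((b u : ℝ) : ℂ)) :=
    ofRealCLM.contDiff.comp b.contDiff
  let Φ := hc.toSchwartzMap hs
  have hΦ : ∀ u, Φ u = ((b u : ℝ) : ℂ) := fun u => rfl
  refine ⟨fun u => b u, (FourierTransformInv.fourierInv Φ : SchwartzMap ℝ ℂ), fun u => b.nonneg, ?_, ?_,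
    b.continuous, fun u => b.le_one, SchwartzMap.integrable _, ?_⟩
  · intro u hu
    refine b.one_of_mem_closedBall ?_
    rw [mem_closedBall_zero_iff]
    exact hu
  · intro u hu
    refine b.zero_of_le_dist ?_
    rw [dist_zero_right]
    exact hu
  · intro u
    rw [← hΦ, ← SchwartzMap.fourier_coe]
    rw [FourierTransform.fourier_fourierInv_eq]

lemma fourier_scaled {φ : ℝ → ℝ} {g : ℝ → ℂ} 
    (h : ∀ u, FourierTransform.fourier g u = (φ u : ℂ)) {δ : ℝ} (hδ : 0 < δ) (m u : ℝ) :
    FourierTransform.fourier (fun y : ℝ => (δ : ℂ) * (cexp ((2 * Real.pi * m * y : ℝ) * I) * g (δ * y))) u =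
      (φ ((u - m) / δ) : ℂ) := by
  rw [← h, Real.fourier_real_eq_integral_exp_smul, Real.fourier_real_eq_integral_exp_smul]
  have := Measure.integral_comp_mul_left
    (fun v : ℝ => cexp (↑(-2 * Real.pi * v * ((u - m) / δ)) * I) • g v) δ
  rw [abs_of_pos (inv_pos.mpr hδ)] at this
  have h2 : ∫ v : ℝ, cexp (↑(-2 * Real.pi * v * ((u - m) / δ)) * I) • g v =
      (δ : ℂ) * ∫ y : ℝ, cexp (↑(-2 * Real.pi * (δ * y) * ((u - m) / δ)) * I) • g (δ * y) := by
    have hne : (δ : ℂ) ≠ 0 := by exact_mod_cast hδ.ne'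
    rw [this, real_smul, ← mul_assoc, ofReal_inv, mul_inv_cancel₀ hne, one_mul]
  rw [h2, ← integral_const_mul]
  congr 1
  funext y
  simp only [smul_eq_mul]
  have e : cexp (↑(-2 * Real.pi * (δ * y) * ((u - m) / δ)) * I) =
      cexp (↑(-2 * Real.pi * y * u) * I) * cexp ((2 * Real.pi * m * y : ℝ) * I) := by
    rw [← Complex.exp_add]
    congr 1
    have : (δ : ℂ) ≠ 0 := by exact_mod_cast hδ.ne'
    push_cast
    field_simp
    ring
  rw [e]
  ring

lemma kernel_tendsto {g : ℝ → ℂ} (hg : Integrable g) (C : ℝ) (hC : 0 < C) :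
    Tendsto (fun δ : ℝ => ∫ y, C / (1 + |2 * Real.pi * (y / δ)| ^ (2 / 5 : ℝ)) * ‖g y‖) (𝓝[>] 0) (𝓝 0) := by
  suffices key : Tendsto (fun δ : ℝ => ∫ y, C / (1 + |2 * Real.pi * (y / δ)| ^ (2 / 5 : ℝ)) * ‖g y‖)
      (𝓝[>] 0) (𝓝 (∫ y : ℝ, (0 : ℝ))) by
    rwa [integral_zero] at key
  refine tendsto_integral_filter_of_dominated_convergence (fun y => C * ‖g y‖) ?_ ?_
    (hg.norm.const_mul C) ?_
  · refine Eventually.of_forall fun δ => ?_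
    refine AEStronglyMeasurable.mul (Measurable.aestronglyMeasurable ?_) hg.norm.aestronglyMeasurable
    fun_prop
  · refine Eventually.of_forall fun δ => Eventually.of_forall fun y => ?_
    rw [Real.norm_of_nonneg (by positivity)]
    gcongr
    refine div_le_self hC.le ?_
    have : 0 ≤ |2 * Real.pi * (y / δ)| ^ (2 / 5 : ℝ) := by positivity
    linarith
  · have : ∀ᵐ y : ℝ, y ≠ 0 := by
      simp [ae_iff]
    filter_upwards [this] with y hy
    suffices hz : Tendsto (fun δ : ℝ => C / (1 + |2 * Real.pi * (y / δ)| ^ (2 / 5 : ℝ)) * ‖g y‖)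
        (𝓝[>] 0) (𝓝 (0 * ‖g y‖)) by
      rwa [zero_mul] at hz
    refine Tendsto.mul_const _ ?_
    refine Tendsto.div_atTop tendsto_const_nhds ?_
    refine tendsto_atTop_add_const_left _ _ ?_
    refine (tendsto_rpow_atTop (by norm_num)).comp ?_
    have e : (fun δ : ℝ => |2 * Real.pi * (y / δ)|) = fun δ : ℝ => |2 * Real.pi * y| * |δ⁻¹| := by
      funext δ
      rw [← abs_mul]; congr 1; ring
    rw [e]
    refine Tendsto.const_mul_atTop ?_ (tendsto_abs_atTop_atTop.comp tendsto_inv_nhdsGT_zero)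
    have := Real.pi_pos
    positivity

lemma smoothed {φ : ℝ → ℝ} {g : ℝ → ℂ} (hg : Integrable g)
    (h : ∀ u, FourierTransform.fourier g u = (φ u : ℂ)) :
    ∃ η : ℝ → ℝ, Tendsto η (𝓝[>] 0) (𝓝 0) ∧ ∀ a δ m : ℝ, 0 < a → a ≤ 1 → 0 < δ →
      ‖∫ u, w a u * (φ ((u - m) / δ) : ℂ)‖ ≤ η δ := by
  obtain ⟨C, hC, hF⟩ := F_bound
  refine ⟨_, kernel_tendsto hg C hC, ?_⟩
  intro a δ m ha ha1 hδ
  set G : ℝ → ℂ := fun y : ℝ => (δ : ℂ) * (cexp ((2 * Real.pi * m * y : ℝ) * I) * g (δ * y)) with hG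
  have hgδ : Integrable fun y => g (δ * y) := hg.comp_mul_left' hδ.ne'
  have hGn : ∀ y, ‖G y‖ = δ * ‖g (δ * y)‖ := by
    intro y
    rw [hG]
    simp only [norm_mul, norm_exp_ofReal_mul_I, norm_real, Real.norm_of_nonneg hδ.le, one_mul]
  have hGi : Integrable G := by
    refine (hgδ.norm.const_mul δ).mono ?_ (Eventually.of_forall fun y => ?_)
    · refine AEStronglyMeasurable.const_mul (AEStronglyMeasurable.mul ?_ hgδ.aestronglyMeasurable) _
      refine Continuous.aestronglyMeasurable ?_
      fun_prop
    · rw [hGn, norm_mul, norm_norm, Real.norm_of_nonneg hδ.le]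
  have key := VectorFourier.integral_fourierIntegral_smul_eq_flip (e := Real.fourierChar)
    (μ := volume) (ν := volume) (L := innerₗ ℝ) (f := w a) (g := G)
    Real.continuous_fourierChar (by exact continuous_inner) (w_integrable ha) hGi
  rw [flip_innerₗ] at key
  have key' : ∫ y, FourierTransform.fourier (w a) y * G y = ∫ u, w a u * FourierTransform.fourier G u := key
  have e1 : ∫ u, w a u * (φ ((u - m) / δ) : ℂ) = ∫ u, w a u * FourierTransform.fourier G u := by
    congr 1
    funext u
    rw [hG, fourier_scaled h hδ]
  rw [e1, ← key']
  have hB : ∀ y, ‖FourierTransform.fourier (w a) y * G y‖ ≤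
      (fun z => δ * (C / (1 + |2 * Real.pi * (z / δ)| ^ (2 / 5 : ℝ)) * ‖g z‖)) (δ * y) := by
    intro y
    rw [norm_mul, hGn, fourier_w ha]
    have := hF (1 + a) (-(2 * Real.pi * y)) (by linarith) (by linarith)
    rw [abs_neg] at this
    simp only
    rw [mul_div_cancel_left₀ _ hδ.ne']
    calc _ ≤ C / (1 + |2 * Real.pi * y| ^ (2 / 5 : ℝ)) * (δ * ‖g (δ * y)‖) := by gcongr
      _ = _ := by ring
  refine (norm_integral_le_of_norm_le ?_ (Eventually.of_forall hB)).trans (le_of_eq ?_)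
  · refine Integrable.comp_mul_left' (g := fun z => δ * (C / (1 + |2 * Real.pi * (z / δ)| ^ (2 / 5 : ℝ)) * ‖g z‖))
      ?_ hδ.ne'
    refine Integrable.const_mul ?_ _
    refine (hg.norm.const_mul C).mono ?_ (Eventually.of_forall fun y => ?_)
    · refine AEStronglyMeasurable.mul (Measurable.aestronglyMeasurable ?_) hg.norm.aestronglyMeasurable
      fun_prop
    · rw [Real.norm_of_nonneg (by positivity), Real.norm_of_nonneg (by positivity)]
      gcongr
      refine div_le_self hC.le ?_
      have : 0 ≤ |2 * Real.pi * (y / δ)| ^ (2 / 5 : ℝ) := by positivity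
      linarith
  · rw [Measure.integral_comp_mul_left
      (fun z => δ * (C / (1 + |2 * Real.pi * (z / δ)| ^ (2 / 5 : ℝ)) * ‖g z‖)) δ, integral_const_mul,
      abs_of_pos (inv_pos.mpr hδ), smul_eq_mul, ← mul_assoc, inv_mul_cancel₀ hδ.ne', one_mul]

end PNT

namespace PNT
open Complex Filter Topology MeasureTheory

lemma window_lower {φ : ℝ → ℝ} (h0 : ∀ u, 0 ≤ φ u) (h1 : ∀ u, |u| ≤ 1 / 2 → φ u = 1)
    (h2 : ∀ u, 1 ≤ |u| → φ u = 0) (hcont : Continuous φ) (hle : ∀ u, φ u ≤ 1)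
    {a δ m c s : ℝ} (ha : 0 < a) (hδ : 0 < δ) (hc : 0 ≤ c) (hs : |s| = 1)
    (hq : ∀ u, |u - m| ≤ δ → c ≤ s * (w a u).re) :
    c * δ ≤ ‖∫ u, w a u * (φ ((u - m) / δ) : ℂ)‖ := by
  have hinteg : Integrable fun u => w a u * (φ ((u - m) / δ) : ℂ) := by
    refine (w_integrable ha).mul_bdd (c := 1) ?_ (Eventually.of_forall fun u => ?_)
    · refine Continuous.aestronglyMeasurable ?_
      fun_prop
    · rw [norm_real, Real.norm_of_nonneg (h0 _)]
      exact hle _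
  have hre : (∫ u, w a u * (φ ((u - m) / δ) : ℂ)).re = ∫ u, (w a u).re * φ ((u - m) / δ) := by
    have := integral_re hinteg
    simp only [RCLike.re_eq_complex_re, re_mul_ofReal] at this
    exact this.symm
  have hintr : Integrable fun u => (w a u).re * φ ((u - m) / δ) := by
    have := hinteg.re
    simpa only [RCLike.re_eq_complex_re, re_mul_ofReal] using this
  have hI : ∫ u, (Set.Icc (m - δ / 2) (m + δ / 2)).indicator (fun _ => c) u = c * δ := by
    rw [integral_indicator measurableSet_Icc, setIntegral_const, smul_eq_mul, Real.volume_real_Icc_of_le (by linarith)]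
    ring
  have hmono : ∫ u, (Set.Icc (m - δ / 2) (m + δ / 2)).indicator (fun _ => c) u ≤
      ∫ u, s * ((w a u).re * φ ((u - m) / δ)) := by
    refine integral_mono ?_ (hintr.const_mul s) fun u => ?_
    · refine (integrable_indicator_iff measurableSet_Icc).mpr ?_
      exact integrableOn_const (by simp)
    · show _ ≤ s * ((w a u).re * φ ((u - m) / δ))
      have habs : |(u - m) / δ| = |u - m| / δ := by rw [abs_div, abs_of_pos hδ]
      by_cases hu : |u - m| ≤ δ
      · have hq' := hq u hu
        have hpos : 0 ≤ s * ((w a u).re * φ ((u - m) / δ)) := by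
          rw [← mul_assoc]
          exact mul_nonneg (hc.trans hq') (h0 _)
        by_cases hm : u ∈ Set.Icc (m - δ / 2) (m + δ / 2)
        · rw [Set.indicator_of_mem hm, h1, mul_one]
          · exact hq'
          · rw [habs, div_le_iff₀ hδ, abs_le]
            constructor <;> linarith [hm.1, hm.2]
        · rw [Set.indicator_of_notMem hm]
          exact hpos
      · push Not at hu
        rw [h2 _ (by rw [habs, le_div_iff₀ hδ]; linarith), Set.indicator_of_notMem]
        · simp
        · intro hm
          have : |u - m| ≤ δ := by
            rw [abs_le]
            constructor <;> linarith [hm.1, hm.2]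
          linarith
  rw [hI, integral_const_mul, ← hre] at hmono
  refine hmono.trans ((le_abs_self _).trans ?_)
  rw [abs_mul, hs, one_mul]
  exact abs_re_le_norm _

lemma w_re {a u : ℝ} (hu : u < 0) : (w a u).re =
    Real.exp (a * u) * u ^ 2 * (Chebyshev.psi (Real.exp (-u)) / Real.exp (-u) - 1) := by
  have : 1 < Real.exp (-u) := by
    rw [Real.one_lt_exp_iff]; linarith
  rw [w, H_of_lt this, ← ofReal_mul, ofReal_re]

lemma pref_lower {U t u : ℝ} (hU : 1 ≤ U) (ht1 : t ≤ 1)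
    (h1 : U - t / 4 ≤ -u) (h2 : -u ≤ U + t / 4) :
    Real.exp (-2) * (U ^ 2 / 4) ≤ Real.exp (1 / U * u) * u ^ 2 := by
  have hU0 : 0 < U := by linarith
  have : -2 ≤ 1 / U * u := by
    rw [one_div, inv_mul_eq_div, le_div_iff₀ hU0]
    linarith
  gcongr
  nlinarith

lemma tauber_core {φ : ℝ → ℝ} (h0 : ∀ u, 0 ≤ φ u) (h1 : ∀ u, |u| ≤ 1 / 2 → φ u = 1)
    (h2 : ∀ u, 1 ≤ |u| → φ u = 0) (hcont : Continuous φ) (hle : ∀ u, φ u ≤ 1)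
    {η : ℝ → ℝ} (hη : ∀ a δ m : ℝ, 0 < a → a ≤ 1 → 0 < δ →
      ‖∫ u, w a u * (φ ((u - m) / δ) : ℂ)‖ ≤ η δ) {ε U : ℝ} (hε : 0 < ε) (hε1 : ε ≤ 1) (hU : 1 ≤ U)
    (hbad : ε / U ≤ |Chebyshev.psi (Real.exp U) / Real.exp U - 1|) :
    Real.exp (-2) * ε ^ 2 / 64 ≤ η (ε / (8 * U)) := by
  have hU0 : 0 < U := by linarith
  obtain ⟨t, htd⟩ : ∃ t, t = ε / U := ⟨_, rfl⟩
  have ht0 : 0 < t := by rw [htd]; positivity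
  have htε : t * U = ε := by rw [htd]; field_simp
  have ht1 : t ≤ 1 := by rw [htd, div_le_one hU0]; linarith
  have hδ : ε / (8 * U) = t / 8 := by rw [htd]; field_simp
  rw [hδ]
  have hcδ : Real.exp (-2) * ε ^ 2 / 64 = Real.exp (-2) * (U ^ 2 / 4) * (t / 2) * (t / 8) := by
    rw [← htε]; ring
  have ha : 0 < 1 / U := by positivity
  have ha1 : 1 / U ≤ 1 := by rw [div_le_one hU0]; exact hU
  rw [hcδ]
  rw [← htd] at hbad
  have hx : 0 < Real.exp U := Real.exp_pos U
  rcases le_abs.mp hbad with hb | hb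
  · refine le_trans ?_ (hη (1 / U) (t / 8) (-(U + t / 8)) ha ha1 (by positivity))
    refine window_lower h0 h1 h2 hcont hle (s := 1) ha (by positivity) (by positivity) (by simp) ?_
    intro u hu
    rw [abs_le] at hu
    rw [w_re (by linarith), one_mul]
    have hp := pref_lower hU ht1 (u := u) (by linarith) (by linarith)
    refine mul_le_mul hp ?_ (by positivity) (by positivity)
    have hy : 0 < Real.exp (-u) := Real.exp_pos _
    have hmon : Chebyshev.psi (Real.exp U) ≤ Chebyshev.psi (Real.exp (-u)) :=
      Chebyshev.psi_mono (Real.exp_le_exp.mpr (by linarith))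
    have hxy : (1 - t / 4) * Real.exp (-u) ≤ Real.exp U := by
      have e : Real.exp U = Real.exp (U + u) * Real.exp (-u) := by rw [← Real.exp_add]; congr 1; ring
      rw [e]
      gcongr
      linarith [Real.add_one_le_exp (U + u)]
    have hψ : (1 + t) * Real.exp U ≤ Chebyshev.psi (Real.exp U) := by
      rw [← le_div_iff₀ hx]; linarith
    have : (1 + t / 2) * Real.exp (-u) ≤ Chebyshev.psi (Real.exp (-u)) := by
      calc _ ≤ (1 + t) * ((1 - t / 4) * Real.exp (-u)) := by
            rw [← mul_assoc]
            gcongr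
            nlinarith
        _ ≤ (1 + t) * Real.exp U := by gcongr
        _ ≤ _ := hψ.trans hmon
    rw [← le_div_iff₀ hy] at this
    linarith
  · refine le_trans ?_ (hη (1 / U) (t / 8) (-(U - t / 8)) ha ha1 (by positivity))
    refine window_lower h0 h1 h2 hcont hle (s := -1) ha (by positivity) (by positivity) (by simp) ?_
    intro u hu
    rw [abs_le] at hu
    rw [w_re (by linarith), neg_one_mul, ← mul_neg]
    have hp := pref_lower hU ht1 (u := u) (by linarith) (by linarith)
    refine mul_le_mul hp ?_ (by positivity) (by positivity)
    have hy : 0 < Real.exp (-u) := Real.exp_pos _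
    have hmon : Chebyshev.psi (Real.exp (-u)) ≤ Chebyshev.psi (Real.exp U) :=
      Chebyshev.psi_mono (Real.exp_le_exp.mpr (by linarith))
    have hxy : (1 - t / 4) * Real.exp U ≤ Real.exp (-u) := by
      have e : Real.exp (-u) = Real.exp (-u - U) * Real.exp U := by rw [← Real.exp_add]; congr 1; ring
      rw [e]
      gcongr
      linarith [Real.add_one_le_exp (-u - U)]
    have hψ : Chebyshev.psi (Real.exp U) ≤ (1 - t) * Real.exp U := by
      rw [← div_le_iff₀ hx]; linarith
    have : Chebyshev.psi (Real.exp (-u)) ≤ (1 - t / 2) * Real.exp (-u) := by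
      calc _ ≤ (1 - t) * Real.exp U := hmon.trans hψ
        _ ≤ (1 - t / 2) * ((1 - t / 4) * Real.exp U) := by
            rw [← mul_assoc]
            gcongr
            nlinarith
        _ ≤ _ := by
            gcongr
            linarith
    rw [← div_le_iff₀ hy] at this
    linarith

theorem psi_asymp :
    Tendsto (fun x : ℝ => Real.log x * (Chebyshev.psi x / x - 1)) atTop (𝓝 0) := by
  obtain ⟨φ, g, h0, h1, h2, hcont, hle, hg, hfour⟩ := exists_test
  obtain ⟨η, hη0, hη⟩ := smoothed hg hfour
  rw [Metric.tendsto_nhds]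
  intro ε0 hε0
  obtain ⟨ε, hε, hε1, hεε⟩ : ∃ ε : ℝ, 0 < ε ∧ ε ≤ 1 ∧ ε ≤ ε0 :=
    ⟨min 1 ε0, by positivity, min_le_left _ _, min_le_right _ _⟩
  have hlim : Tendsto (fun x : ℝ => ε / (8 * Real.log x)) atTop (𝓝[>] 0) := by
    rw [tendsto_nhdsWithin_iff]
    refine ⟨Tendsto.div_atTop tendsto_const_nhds
      (Real.tendsto_log_atTop.const_mul_atTop (by norm_num)), ?_⟩
    filter_upwards [Real.tendsto_log_atTop.eventually_ge_atTop 1] with x hx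
    have : 0 < Real.log x := by linarith
    exact Set.mem_Ioi.mpr (by positivity)
  have hev := (hη0.comp hlim).eventually_lt_const (u := Real.exp (-2) * ε ^ 2 / 64) (by positivity)
  filter_upwards [hev, Real.tendsto_log_atTop.eventually_ge_atTop 1, eventually_gt_atTop 0]
    with x hx hL hx0
  have hL0 : 0 < Real.log x := by linarith
  rw [dist_zero_right, Real.norm_eq_abs, abs_mul, abs_of_pos hL0]
  by_contra hcon
  push Not at hcon
  have := tauber_core h0 h1 h2 hcont hle hη hε hε1 hL (by
    rw [Real.exp_log hx0, div_le_iff₀ hL0, mul_comm]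
    exact hεε.trans hcon)
  simp only [Function.comp] at hx
  linarith

end PNT

namespace PNT
open Filter Topology MeasureTheory

theorem theta_asymp :
    Tendsto (fun x : ℝ => Real.log x * (Chebyshev.theta x / x - 1)) atTop (𝓝 0) := by
  have hd : Tendsto (fun x : ℝ => Real.log x * ((Chebyshev.psi x - Chebyshev.theta x) / x))
      atTop (𝓝 0) := by
    have hb : Tendsto (fun x : ℝ => 2 * (Real.log x ^ 2 / x ^ (1 / 2 : ℝ))) atTop (𝓝 0) := by
      have h := (isLittleO_log_rpow_rpow_atTop (s := 1 / 2) 2 (by norm_num)).tendsto_div_nhds_zero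
      have h' := h.const_mul 2
      rw [mul_zero] at h'
      refine h'.congr fun x => ?_
      simp
    refine squeeze_zero' ?_ ?_ hb
    · filter_upwards [eventually_ge_atTop 1] with x hx
      have := Chebyshev.theta_le_psi x
      have := Real.log_nonneg hx
      exact mul_nonneg this (div_nonneg (by linarith) (by linarith))
    · filter_upwards [eventually_ge_atTop 1] with x hx
      have hx0 : 0 < x := by linarith
      have h1 := Chebyshev.psi_sub_theta_le hx
      have hl := Real.log_nonneg hx
      rw [← Real.sqrt_eq_rpow]
      have hs : 0 < √x := Real.sqrt_pos.mpr hx0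
      calc _ ≤ Real.log x * ((2 * √x * Real.log x) / x) := by gcongr
        _ = Real.log x * ((2 * √x * Real.log x) / (√x * √x)) := by rw [Real.mul_self_sqrt hx0.le]
        _ = _ := by field_simp
  have := psi_asymp.sub hd
  rw [sub_zero] at this
  refine this.congr fun x => ?_
  ring

theorem theta_div_tendsto : Tendsto (fun x : ℝ => Chebyshev.theta x / x - 1) atTop (𝓝 0) := by
  have := theta_asymp.mul (tendsto_inv_atTop_zero.comp Real.tendsto_log_atTop)
  rw [zero_mul] at this
  refine this.congr' ?_
  filter_upwards [Real.tendsto_log_atTop.eventually_ge_atTop 1] with x hx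
  have : Real.log x ≠ 0 := by linarith
  simp only [Function.comp]
  field_simp

/-- The auxiliary integrand. -/
noncomputable def rem (t : ℝ) : ℝ :=
  Chebyshev.theta t / (t * Real.log t ^ 2) - (1 / Real.log t ^ 2 - 2 / Real.log t ^ 3)

lemma log_pos_of {t : ℝ} (ht : 2 ≤ t) : 0 < Real.log t := Real.log_pos (by linarith)

lemma theta_ii {a b : ℝ} (ha : 2 ≤ a) (hab : a ≤ b) :
    IntervalIntegrable (fun t => Chebyshev.theta t / (t * Real.log t ^ 2)) volume a b := by
  rw [intervalIntegrable_iff_integrableOn_Icc_of_le hab]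
  exact (Chebyshev.integrableOn_theta_div_id_mul_log_sq b).mono_set (Set.Icc_subset_Icc_left ha)

lemma main_ii {a b : ℝ} (ha : 2 ≤ a) (hab : a ≤ b) :
    IntervalIntegrable (fun t => 1 / Real.log t ^ 2 - 2 / Real.log t ^ 3) volume a b := by
  refine ContinuousOn.intervalIntegrable ?_
  rw [Set.uIcc_of_le hab]
  intro t ht
  have ht2 : 2 ≤ t := ha.trans ht.1
  have h := (log_pos_of ht2).ne'
  have ht0 : t ≠ 0 := by linarith
  refine ContinuousAt.continuousWithinAt ?_
  have hc : ContinuousAt Real.log t := Real.continuousAt_log ht0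
  exact (continuousAt_const.div (hc.pow 2) (pow_ne_zero 2 h)).sub
    (continuousAt_const.div (hc.pow 3) (pow_ne_zero 3 h))

lemma sq_ii {a b : ℝ} (ha : 2 ≤ a) (hab : a ≤ b) :
    IntervalIntegrable (fun t => 1 / Real.log t ^ 2) volume a b := by
  refine ContinuousOn.intervalIntegrable ?_
  rw [Set.uIcc_of_le hab]
  intro t ht
  have ht2 : 2 ≤ t := ha.trans ht.1
  have h := (log_pos_of ht2).ne'
  have ht0 : t ≠ 0 := by linarith
  refine ContinuousAt.continuousWithinAt ?_
  have hc : ContinuousAt Real.log t := Real.continuousAt_log ht0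
  exact (continuousAt_const.div (hc.pow 2) (pow_ne_zero 2 h))

lemma rem_ii {a b : ℝ} (ha : 2 ≤ a) (hab : a ≤ b) : IntervalIntegrable rem volume a b :=
  (theta_ii ha hab).sub (main_ii ha hab)

lemma main_integral {x : ℝ} (hx : 2 ≤ x) :
    ∫ t in (2:ℝ)..x, (1 / Real.log t ^ 2 - 2 / Real.log t ^ 3) =
      x / Real.log x ^ 2 - 2 / Real.log 2 ^ 2 := by
  refine intervalIntegral.integral_eq_sub_of_hasDerivAt (f := fun t => t / Real.log t ^ 2) ?_
    (main_ii le_rfl hx)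
  intro t ht
  rw [Set.uIcc_of_le hx] at ht
  have h := (log_pos_of ht.1).ne'
  have ht0 : t ≠ 0 := by linarith [ht.1]
  have := (hasDerivAt_id t).div ((Real.hasDerivAt_log ht0).pow 2) (pow_ne_zero 2 h)
  refine this.congr_deriv ?_
  simp only [id]
  field_simp
  simp
  ring

lemma rem_eq {x : ℝ} (hx : 2 ≤ x) :
    ∫ t in (2:ℝ)..x, Chebyshev.theta t / (t * Real.log t ^ 2) =
      x / Real.log x ^ 2 - 2 / Real.log 2 ^ 2 + ∫ t in (2:ℝ)..x, rem t := by
  have : ∫ t in (2:ℝ)..x, rem t = _ := intervalIntegral.integral_sub (theta_ii le_rfl hx) (main_ii le_rfl hx)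
  rw [this, main_integral hx]
  ring

lemma const_small (c : ℝ) : Tendsto (fun x : ℝ => c * (Real.log x ^ 2 / x)) atTop (𝓝 0) := by
  have h := (isLittleO_log_rpow_rpow_atTop (s := 1) 2 (by norm_num)).tendsto_div_nhds_zero
  have h' := h.const_mul c
  rw [mul_zero] at h'
  refine h'.congr fun x => ?_
  simp

lemma rem_small : ∀ ε : ℝ, 0 < ε → ∀ᶠ t in atTop, |rem t| ≤ ε * (1 / Real.log t ^ 2) := by
  intro ε hε
  have h1 : Tendsto (fun t : ℝ => (Chebyshev.theta t / t - 1) + 2 * (Real.log t)⁻¹) atTop (𝓝 0) := by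
    have := theta_div_tendsto.add ((tendsto_inv_atTop_zero.comp Real.tendsto_log_atTop).const_mul 2)
    simpa using this
  rw [Metric.tendsto_nhds] at h1
  filter_upwards [h1 ε hε, eventually_ge_atTop 2] with t ht ht2
  have h := log_pos_of ht2
  have ht0 : 0 < t := by linarith
  have e : rem t = ((Chebyshev.theta t / t - 1) + 2 * (Real.log t)⁻¹) * (1 / Real.log t ^ 2) := by
    rw [rem]
    field_simp
    ring
  rw [dist_zero_right, Real.norm_eq_abs] at ht
  rw [e, abs_mul, abs_of_pos (show 0 < 1 / Real.log t ^ 2 by positivity)]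
  gcongr

lemma rem_integral :
    Tendsto (fun x : ℝ => Real.log x ^ 2 / x * ∫ t in (2:ℝ)..x, rem t) atTop (𝓝 0) := by
  obtain ⟨C, hC, hbig⟩ := Chebyshev.integral_one_div_log_sq_isBigO.exists_pos
  rw [Asymptotics.isBigOWith_iff] at hbig
  rw [Metric.tendsto_nhds]
  intro ε hε
  obtain ⟨T0, hT0⟩ := eventually_atTop.mp (rem_small (ε / (2 * C)) (by positivity))
  obtain ⟨T, hT2, hTT⟩ : ∃ T : ℝ, 2 ≤ T ∧ T0 ≤ T := ⟨max 2 T0, le_max_left _ _, le_max_right _ _⟩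
  have hsm := const_small |∫ t in (2:ℝ)..T, rem t|
  filter_upwards [hsm.eventually_lt_const (u := ε / 2) (by positivity), hbig, eventually_ge_atTop T]
    with x h1 h2 hx
  have hx2 : 2 ≤ x := hT2.trans hx
  have hx0 : 0 < x := by linarith
  have hl := log_pos_of hx2
  have hp : 0 < Real.log x ^ 2 / x := by positivity
  rw [dist_zero_right, Real.norm_eq_abs, abs_mul, abs_of_pos hp,
    ← intervalIntegral.integral_add_adjacent_intervals (rem_ii le_rfl hT2) (rem_ii hT2 hx)]
  have hI : |∫ t in T..x, rem t| ≤ ε / (2 * C) * ∫ t in T..x, 1 / Real.log t ^ 2 := by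
    rw [← intervalIntegral.integral_const_mul, ← Real.norm_eq_abs]
    refine intervalIntegral.norm_integral_le_of_norm_le hx (Eventually.of_forall fun t ht => ?_)
      ((sq_ii hT2 hx).const_mul _)
    exact hT0 t (hTT.trans ht.1.le)
  have hJ : ∫ t in T..x, 1 / Real.log t ^ 2 ≤ ∫ t in (2:ℝ)..x, 1 / Real.log t ^ 2 := by
    rw [← intervalIntegral.integral_add_adjacent_intervals (sq_ii le_rfl hT2) (sq_ii hT2 hx)]
    have : 0 ≤ ∫ t in (2:ℝ)..T, 1 / Real.log t ^ 2 :=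
      intervalIntegral.integral_nonneg hT2 fun t _ => by positivity
    linarith
  have hK : ∫ t in (2:ℝ)..x, 1 / Real.log t ^ 2 ≤ C * (x / Real.log x ^ 2) := by
    refine (le_abs_self _).trans ?_
    rw [Real.norm_eq_abs, Real.norm_of_nonneg (by positivity)] at h2
    exact h2
  have hL : |∫ t in T..x, rem t| ≤ ε / (2 * C) * (C * (x / Real.log x ^ 2)) :=
    hI.trans (mul_le_mul_of_nonneg_left (hJ.trans hK) (by positivity))
  calc _ ≤ Real.log x ^ 2 / x * (|∫ t in (2:ℝ)..T, rem t| + ε / (2 * C) * (C * (x / Real.log x ^ 2))) := by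
        gcongr
        exact (abs_add_le _ _).trans (by linarith)
    _ = |∫ t in (2:ℝ)..T, rem t| * (Real.log x ^ 2 / x) + ε / 2 := by
        field_simp
    _ < ε := by linarith

theorem pi_asymp : Tendsto (fun x : ℝ =>
    Real.log x * ((Nat.primeCounting ⌊x⌋₊ : ℝ) * Real.log x / x - 1)) atTop (𝓝 1) := by
  have h := (theta_asymp.add (rem_integral.sub (const_small (2 / Real.log 2 ^ 2)))).add_const 1
  simp only [sub_zero, zero_add] at h
  refine h.congr' ?_
  filter_upwards [eventually_ge_atTop 2] with x hx
  have hl := log_pos_of hx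
  have hx0 : 0 < x := by linarith
  rw [Chebyshev.primeCounting_eq_theta_div_log_add_integral hx, rem_eq hx]
  have : Real.log 2 ≠ 0 := (log_pos_of le_rfl).ne'
  field_simp
  ring

theorem pi_div_tendsto : Tendsto (fun x : ℝ =>
    (Nat.primeCounting ⌊x⌋₊ : ℝ) * Real.log x / x) atTop (𝓝 1) := by
  have := (pi_asymp.mul (tendsto_inv_atTop_zero.comp Real.tendsto_log_atTop)).add_const 1
  simp only [mul_zero, zero_add] at this
  refine this.congr' ?_
  filter_upwards [eventually_ge_atTop 2] with x hx
  have := (log_pos_of hx).ne'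
  simp only [Function.comp]
  field_simp
  ring

theorem final : Tendsto (fun x : ℝ => Real.log x - x / (Nat.primeCounting ⌊x⌋₊ : ℝ)) atTop (𝓝 1) := by
  have := pi_asymp.div pi_div_tendsto one_ne_zero
  rw [div_one] at this
  refine this.congr' ?_
  filter_upwards [eventually_ge_atTop 2, pi_div_tendsto.eventually_ne one_ne_zero] with x hx hne
  have h1 := (log_pos_of hx).ne'
  have hx0 : x ≠ 0 := by linarith
  have h2 : (Nat.primeCounting ⌊x⌋₊ : ℝ) ≠ 0 := by
    intro h
    rw [h] at hne
    simp at hne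
  simp only [Pi.div_apply]
  field_simp

end PNT

theorem f_tendsto_one :
    Filter.Tendsto (fun x : ℝ => Real.log x - x / primePi x) Filter.atTop (nhds 1) := by exact PNT.final
end
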